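/- arXiv:1606.04355 — 2 statements merged into one kernel-verified Lean document; each statement's English description precedes it below -/
import Mathlib

section
/- For k ∈ (0,1) let x = K(k′)/K(k) where k′ = √(1−k²). Then ∑_{m=1}^∞ 1/sinh²(πmx) = 1/6 + (2(2−k²)/(3π²))K(k)² − (2/π²)K(k)E(k). -/
open Real

/-- The complete elliptic integral of the first kind. -/
noncomputable def ellipticK (k : ℝ) : ℝ :=
  ∫ t in (0:ℝ)..1, 1 / Real.sqrt ((1 - t ^ 2) * (1 - k ^ 2 * t ^ 2))

/-- The complete elliptic integral of the second kind. -/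
noncomputable def ellipticE (k : ℝ) : ℝ :=
  ∫ t in (0:ℝ)..1, Real.sqrt ((1 - k ^ 2 * t ^ 2) / (1 - t ^ 2))

/-- The ratio of elliptic integrals with complementary modulus. -/
noncomputable def xRatio (k : ℝ) : ℝ :=
  ellipticK (Real.sqrt (1 - k ^ 2)) / ellipticK k

section EllipticIntegrals

open MeasureTheory Set Filter Topology

lemma one_sub_sq_pos {t : ℝ} (ht : t ∈ Ioo (0:ℝ) 1) : 0 < 1 - t ^ 2 := by
  nlinarith [ht.1, ht.2]

lemma one_sub_mul_sq_lower {k t : ℝ} (ht : t ∈ Ioo (0:ℝ) 1) :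
    1 - k ^ 2 ≤ 1 - k ^ 2 * t ^ 2 := by
  nlinarith [one_sub_sq_pos ht, sq_nonneg k]

lemma intervalIntegrable_ellipticK {k : ℝ} (hk : k ^ 2 < 1) :
    IntervalIntegrable (fun t : ℝ ↦ 1 / √((1 - t ^ 2) * (1 - k ^ 2 * t ^ 2))) volume 0 1 := by
  have h1 : IntervalIntegrable (fun t : ℝ ↦ (1 / √(1 - k ^ 2)) * (1 - t) ^ (-(1 / 2) : ℝ))
      volume 0 1 := by
    have := (intervalIntegral.intervalIntegrable_rpow' (a := 0) (b := 1)
      (r := -(1 / 2)) (by norm_num)).comp_sub_left 1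
    simpa using! (this.symm.const_mul (1 / √(1 - k ^ 2)))
  rw [intervalIntegrable_iff_integrableOn_Ioo_of_le zero_le_one] at h1 ⊢
  refine h1.mono' (by measurability)
    ((ae_restrict_iff' measurableSet_Ioo).2 (.of_forall fun t ht ↦ ?_))
  have hk' : 0 < 1 - k ^ 2 := by linarith
  have ht' : 0 < 1 - t := by linarith [ht.2]
  rw [norm_of_nonneg (by positivity), rpow_neg ht'.le, ← sqrt_eq_rpow, ← one_div,
    one_div_mul_one_div, ← sqrt_mul hk'.le]
  apply one_div_le_one_div_of_le (by positivity)
  apply sqrt_le_sqrt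
  rw [mul_comm]
  apply mul_le_mul _ (one_sub_mul_sq_lower ht) hk'.le (one_sub_sq_pos ht).le
  nlinarith [ht.1, ht.2]

lemma intervalIntegrable_mul_ellipticK {k : ℝ} (hk : k ^ 2 < 1) {g : ℝ → ℝ}
    (hg : ContinuousOn g (Icc 0 1)) :
    IntervalIntegrable (fun t : ℝ ↦ g t * (1 / √((1 - t ^ 2) * (1 - k ^ 2 * t ^ 2))))
      volume 0 1 :=
  (intervalIntegrable_ellipticK hk).continuousOn_mul (by simpa using hg)

lemma intervalIntegral_congr_Ioo {f g : ℝ → ℝ} (h : ∀ t ∈ Ioo (0:ℝ) 1, f t = g t) :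
    ∫ t in (0:ℝ)..1, f t = ∫ t in (0:ℝ)..1, g t := by
  rw [intervalIntegral.integral_of_le zero_le_one, intervalIntegral.integral_of_le zero_le_one,
    integral_Ioc_eq_integral_Ioo, integral_Ioc_eq_integral_Ioo]
  exact setIntegral_congr_fun measurableSet_Ioo h

lemma ellipticE_eq {k : ℝ} (hk : k ^ 2 < 1) :
    ellipticE k = ∫ t in (0:ℝ)..1, (1 - k ^ 2 * t ^ 2) *
      (1 / √((1 - t ^ 2) * (1 - k ^ 2 * t ^ 2))) := by
  refine intervalIntegral_congr_Ioo fun t ht ↦ ?_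
  have h1 := one_sub_sq_pos ht
  have h2 : 0 < 1 - k ^ 2 * t ^ 2 := by linarith [one_sub_mul_sq_lower (k := k) ht]
  rw [sqrt_div h2.le, sqrt_mul h1.le]
  have := mul_self_sqrt h2.le
  field_simp
  rw [sq, this]

lemma integral_one_div_sqrt_one_sub_sq : ∫ t in (0:ℝ)..1, 1 / √(1 - t ^ 2) = π / 2 := by
  have h := intervalIntegrable_ellipticK (k := 0) (by norm_num)
  rw [intervalIntegral.integral_eq_sub_of_hasDerivAt_of_le zero_le_one
    (f := arcsin) continuous_arcsin.continuousOn
    (fun t ht ↦ hasDerivAt_arcsin (by linarith [ht.1]) (by linarith [ht.2]))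
    (by simpa using h)]
  simp

lemma intervalIntegrable_one_div_sqrt_one_sub_sq :
    IntervalIntegrable (fun t : ℝ ↦ 1 / √(1 - t ^ 2)) volume 0 1 := by
  simpa using intervalIntegrable_ellipticK (k := 0) (by norm_num)

lemma pi_div_two_le_ellipticK {k : ℝ} (hk : k ^ 2 < 1) : π / 2 ≤ ellipticK k := by
  rw [← integral_one_div_sqrt_one_sub_sq]
  refine intervalIntegral.integral_mono_on_of_le_Ioo zero_le_one
    intervalIntegrable_one_div_sqrt_one_sub_sq (intervalIntegrable_ellipticK hk) fun t ht ↦ ?_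
  have h1 := one_sub_sq_pos ht
  have h2 : 0 < 1 - k ^ 2 * t ^ 2 := by linarith [one_sub_mul_sq_lower (k := k) ht]
  apply one_div_le_one_div_of_le (by positivity)
  apply sqrt_le_sqrt
  have : 0 ≤ k ^ 2 * t ^ 2 := by positivity
  nlinarith

lemma ellipticK_pos {k : ℝ} (hk : k ^ 2 < 1) : 0 < ellipticK k :=
  (by positivity : 0 < π / 2).trans_le (pi_div_two_le_ellipticK hk)

lemma ellipticK_le {k : ℝ} (hk : k ^ 2 < 1) : ellipticK k ≤ π / 2 / (1 - k ^ 2) := by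
  rw [← integral_one_div_sqrt_one_sub_sq, ← intervalIntegral.integral_div]
  refine intervalIntegral.integral_mono_on_of_le_Ioo zero_le_one
    (intervalIntegrable_ellipticK hk)
    (intervalIntegrable_one_div_sqrt_one_sub_sq.div_const _) fun t ht ↦ ?_
  have h1 := one_sub_sq_pos ht
  have h3 := one_sub_mul_sq_lower (k := k) ht
  have h4 : 0 < 1 - k ^ 2 := by linarith
  rw [div_div]
  apply one_div_le_one_div_of_le (by positivity)
  rw [sqrt_mul h1.le]
  gcongr
  refine le_trans ?_ (sqrt_le_sqrt h3)
  apply le_sqrt_of_sq_le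
  nlinarith [sq_nonneg k]

lemma ellipticE_le {k : ℝ} (hk : k ^ 2 < 1) : ellipticE k ≤ π / 2 / (1 - k ^ 2) := by
  refine le_trans ?_ (ellipticK_le hk)
  rw [ellipticE_eq hk]
  refine intervalIntegral.integral_mono_on_of_le_Ioo zero_le_one
    (intervalIntegrable_mul_ellipticK hk (by fun_prop)) (intervalIntegrable_ellipticK hk)
    fun t ht ↦ mul_le_of_le_one_left (by positivity) ?_
  nlinarith [sq_nonneg (k * t)]

lemma le_ellipticE {k : ℝ} (hk : k ^ 2 < 1) : π / 2 * (1 - k ^ 2) ≤ ellipticE k := by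
  have h4 : 0 < 1 - k ^ 2 := by linarith
  refine (mul_le_mul_of_nonneg_right (pi_div_two_le_ellipticK hk) h4.le).trans ?_
  rw [ellipticE_eq hk, mul_comm, ellipticK, ← intervalIntegral.integral_const_mul]
  exact intervalIntegral.integral_mono_on_of_le_Ioo zero_le_one
    ((intervalIntegrable_ellipticK hk).const_mul _)
    (intervalIntegrable_mul_ellipticK hk (by fun_prop))
    fun t ht ↦ mul_le_mul_of_nonneg_right (one_sub_mul_sq_lower ht) (by positivity)

lemma ellipticK_lt {k l : ℝ} (hkl : k ^ 2 < l ^ 2) (hl : l ^ 2 < 1) :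
    ellipticK k < ellipticK l := by
  have ik := intervalIntegrable_ellipticK (hkl.trans hl)
  have il := intervalIntegrable_ellipticK hl
  rw [← sub_pos, ellipticK, ellipticK, ← intervalIntegral.integral_sub il ik]
  refine intervalIntegral.intervalIntegral_pos_of_pos_on (il.sub ik) (fun t ht ↦ ?_) zero_lt_one
  have h1 := one_sub_sq_pos ht
  have h2 := one_sub_mul_sq_lower (k := l) ht
  rw [sub_pos]
  have h5 : 0 < 1 - l ^ 2 * t ^ 2 := by linarith
  apply one_div_lt_one_div_of_lt (by positivity)
  apply sqrt_lt_sqrt (by positivity)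
  have h3 : 0 < t ^ 2 := by have := ht.1; positivity
  gcongr

lemma xRatio_injOn : InjOn xRatio (Ioo 0 1) := by
  have key : ∀ k ∈ Ioo (0:ℝ) 1, ∀ l ∈ Ioo (0:ℝ) 1, k < l → xRatio l < xRatio k := by
    intro k hk l hl hkl
    have hkl2 : k ^ 2 < l ^ 2 := by nlinarith [hk.1]
    have hl2 : l ^ 2 < 1 := by nlinarith [hl.1, hl.2]
    have hk2 : 0 < k ^ 2 := by have := hk.1; positivity
    have hk' : √(1 - k ^ 2) ^ 2 = 1 - k ^ 2 := sq_sqrt (by linarith)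
    have hl' : √(1 - l ^ 2) ^ 2 = 1 - l ^ 2 := sq_sqrt (by linarith)
    refine div_lt_div₀ (ellipticK_lt ?_ ?_) (ellipticK_lt hkl2 hl2).le
      (ellipticK_pos ?_).le (ellipticK_pos ?_) <;> linarith
  intro k hk l hl h
  rcases lt_trichotomy k l with h' | h' | h'
  · exact absurd h (key k hk l hl h').ne'
  · exact h'
  · exact absurd h (key l hl k hk h').ne

lemma hasDerivAt_gauss {κ : ℝ} (h0 : 0 ≤ κ) (s : ℝ) :
    HasDerivAt (fun s : ℝ ↦ (1 + κ) * s / (1 + κ * s ^ 2))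
      ((1 + κ) * (1 - κ * s ^ 2) / (1 + κ * s ^ 2) ^ 2) s := by
  have hp : 1 + κ * s ^ 2 ≠ 0 := by positivity
  refine (((hasDerivAt_id s).const_mul (1 + κ)).fun_div
    (((hasDerivAt_pow 2 s).const_mul κ).const_add 1) hp).congr_deriv ?_
  simp
  ring

lemma integral_gauss {κ : ℝ} (h0 : 0 ≤ κ) (h1 : κ < 1) (g : ℝ → ℝ) :
    ∫ t in (0:ℝ)..1, g t = ∫ s in (0:ℝ)..1,
      ((1 + κ) * (1 - κ * s ^ 2) / (1 + κ * s ^ 2) ^ 2) *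
        g ((1 + κ) * s / (1 + κ * s ^ 2)) := by
  set φ : ℝ → ℝ := fun s ↦ (1 + κ) * s / (1 + κ * s ^ 2) with hφ
  have hd := hasDerivAt_gauss h0
  have hc : Continuous φ := continuous_iff_continuousAt.2 fun s ↦ (hd s).continuousAt
  have hpos : ∀ s ∈ Ioo (0:ℝ) 1, 0 < (1 + κ) * (1 - κ * s ^ 2) / (1 + κ * s ^ 2) ^ 2 := by
    intro s hs
    have : 0 < 1 - κ * s ^ 2 := by nlinarith [one_sub_sq_pos hs]
    positivity
  have hmono : StrictMonoOn φ (Icc 0 1) := by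
    refine strictMonoOn_of_deriv_pos (convex_Icc 0 1) hc.continuousOn fun s hs ↦ ?_
    rw [interior_Icc] at hs
    rw [(hd s).deriv]
    exact hpos s hs
  have hφ0 : φ 0 = 0 := by simp [hφ]
  have hφ1 : φ 1 = 1 := by
    have : 1 + κ ≠ 0 := by positivity
    simp [hφ, this]
  have himg : φ '' Ioo 0 1 = Ioo 0 1 := by
    apply Subset.antisymm
    · rintro _ ⟨s, hs, rfl⟩
      have h01 := hmono (left_mem_Icc.2 zero_le_one) (Ioo_subset_Icc_self hs) hs.1
      have h02 := hmono (Ioo_subset_Icc_self hs) (right_mem_Icc.2 zero_le_one) hs.2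
      rw [hφ0] at h01
      rw [hφ1] at h02
      exact ⟨h01, h02⟩
    · have := intermediate_value_Ioo zero_le_one hc.continuousOn
      rwa [hφ0, hφ1] at this
  have := integral_image_eq_integral_abs_deriv_smul (s := Ioo 0 1) measurableSet_Ioo
    (fun s _ ↦ (hd s).hasDerivWithinAt) (hmono.injOn.mono Ioo_subset_Icc_self) g
  rw [himg] at this
  rw [intervalIntegral.integral_of_le zero_le_one, intervalIntegral.integral_of_le zero_le_one,
    integral_Ioc_eq_integral_Ioo, integral_Ioc_eq_integral_Ioo, this]
  refine setIntegral_congr_fun measurableSet_Ioo fun s hs ↦ ?_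
  simp only [abs_of_pos (hpos s hs), smul_eq_mul]

lemma landen_integrand {κ k s : ℝ} (h0 : 0 ≤ κ) (h1 : κ < 1) (hk : k ^ 2 = 4 * κ / (1 + κ) ^ 2)
    (hs : s ∈ Ioo (0:ℝ) 1) :
    ((1 + κ) * (1 - κ * s ^ 2) / (1 + κ * s ^ 2) ^ 2) *
      (1 / √((1 - ((1 + κ) * s / (1 + κ * s ^ 2)) ^ 2) *
        (1 - k ^ 2 * ((1 + κ) * s / (1 + κ * s ^ 2)) ^ 2))) =
    (1 + κ) * (1 / √((1 - s ^ 2) * (1 - κ ^ 2 * s ^ 2))) := by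
  have hp : 0 < 1 + κ * s ^ 2 := by positivity
  have hm : 0 < 1 - κ * s ^ 2 := by nlinarith [one_sub_sq_pos hs]
  have hr : 0 < (1 - s ^ 2) * (1 - κ ^ 2 * s ^ 2) := by
    have := one_sub_mul_sq_lower (k := κ) hs
    have h3 : 0 < 1 - κ ^ 2 := by nlinarith
    exact mul_pos (one_sub_sq_pos hs) (by linarith)
  have key : (1 - ((1 + κ) * s / (1 + κ * s ^ 2)) ^ 2) *
        (1 - k ^ 2 * ((1 + κ) * s / (1 + κ * s ^ 2)) ^ 2) =
      ((1 - κ * s ^ 2) / (1 + κ * s ^ 2) ^ 2) ^ 2 * ((1 - s ^ 2) * (1 - κ ^ 2 * s ^ 2)) := by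
    have : 1 + κ ≠ 0 := by positivity
    rw [hk]
    field_simp
    ring
  rw [key, sqrt_mul (by positivity), sqrt_sq (by positivity)]
  field_simp

lemma ellipticK_landen {κ k : ℝ} (h0 : 0 ≤ κ) (h1 : κ < 1)
    (hk : k ^ 2 = 4 * κ / (1 + κ) ^ 2) : ellipticK k = (1 + κ) * ellipticK κ := by
  rw [ellipticK, integral_gauss h0 h1, ellipticK, ← intervalIntegral.integral_const_mul]
  exact intervalIntegral_congr_Ioo fun s hs ↦ landen_integrand h0 h1 hk hs

lemma landen_sq_lt_one {κ k : ℝ} (h0 : 0 ≤ κ) (h1 : κ < 1)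
    (hk : k ^ 2 = 4 * κ / (1 + κ) ^ 2) : k ^ 2 < 1 := by
  rw [hk, div_lt_one (by positivity)]
  nlinarith [sq_pos_of_pos (sub_pos.2 h1)]

lemma hasDerivAt_landen_primitive {κ s : ℝ} (h0 : 0 ≤ κ) (h1 : κ < 1) (hs : s ∈ Ioo (0:ℝ) 1) :
    HasDerivAt (fun s ↦ s * √((1 - s ^ 2) * (1 - κ ^ 2 * s ^ 2)) / (1 + κ * s ^ 2))
      ((((1 - 2 * (1 + κ ^ 2) * s ^ 2 + 3 * κ ^ 2 * s ^ 4) * (1 + κ * s ^ 2)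
        - 2 * κ * s ^ 2 * ((1 - s ^ 2) * (1 - κ ^ 2 * s ^ 2))) / (1 + κ * s ^ 2) ^ 2) *
        (1 / √((1 - s ^ 2) * (1 - κ ^ 2 * s ^ 2)))) s := by
  have hp : 0 < 1 + κ * s ^ 2 := by positivity
  have hr : 0 < (1 - s ^ 2) * (1 - κ ^ 2 * s ^ 2) := by
    have := one_sub_mul_sq_lower (k := κ) hs
    have h3 : 0 < 1 - κ ^ 2 := by nlinarith
    exact mul_pos (one_sub_sq_pos hs) (by linarith)
  have hpoly : HasDerivAt (fun s : ℝ ↦ (1 - s ^ 2) * (1 - κ ^ 2 * s ^ 2))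
      (-(2 * s) * (1 - κ ^ 2 * s ^ 2) + (1 - s ^ 2) * -(κ ^ 2 * (2 * s))) s := by
    refine (((hasDerivAt_pow 2 s).const_sub 1).mul
      (((hasDerivAt_pow 2 s).const_mul (κ ^ 2)).const_sub 1)).congr_deriv ?_
    simp
  have hq : HasDerivAt (fun s : ℝ ↦ 1 + κ * s ^ 2) (κ * (2 * s)) s := by
    refine (((hasDerivAt_pow 2 s).const_mul κ).const_add 1).congr_deriv ?_
    simp
  refine (((hasDerivAt_id s).mul (hpoly.sqrt hr.ne')).div hq hp.ne').congr_deriv ?_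
  have hsq := sq_sqrt hr.le
  simp only [id, one_mul, Pi.mul_apply]
  have hne : √((1 - s ^ 2) * (1 - κ ^ 2 * s ^ 2)) ≠ 0 := (sqrt_pos.2 hr).ne'
  set r := √((1 - s ^ 2) * (1 - κ ^ 2 * s ^ 2))
  field_simp
  rw [hsq]
  ring

lemma ellipticE_landen {κ k : ℝ} (h0 : 0 ≤ κ) (h1 : κ < 1)
    (hk : k ^ 2 = 4 * κ / (1 + κ) ^ 2) :
    (1 + κ) * ellipticE k = 2 * ellipticE κ - (1 - κ ^ 2) * ellipticK κ := by
  have hκ2 : κ ^ 2 < 1 := by nlinarith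
  have hcont : ∀ n : ℕ, ∀ p : ℝ → ℝ, Continuous p →
      ContinuousOn (fun s ↦ p s / (1 + κ * s ^ 2) ^ n) (Icc 0 1) := fun n p hp ↦
    hp.continuousOn.div (by fun_prop) fun s _ ↦ by positivity
  have hprim := intervalIntegral.integral_eq_sub_of_hasDerivAt_of_le zero_le_one
    (f := fun s ↦ s * √((1 - s ^ 2) * (1 - κ ^ 2 * s ^ 2)) / (1 + κ * s ^ 2))
    (by simpa using hcont 1 (fun s ↦ s * √((1 - s ^ 2) * (1 - κ ^ 2 * s ^ 2))) (by fun_prop))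
    (fun s hs ↦ hasDerivAt_landen_primitive h0 h1 hs)
    (intervalIntegrable_mul_ellipticK hκ2 (hcont 2 _ (by fun_prop)))
  have hE : (1 + κ) * ellipticE k = ∫ s in (0:ℝ)..1,
      ((1 + κ) ^ 2 * (1 - κ * s ^ 2) ^ 2 / (1 + κ * s ^ 2) ^ 2) *
        (1 / √((1 - s ^ 2) * (1 - κ ^ 2 * s ^ 2))) := by
    rw [ellipticE_eq (landen_sq_lt_one h0 h1 hk), integral_gauss h0 h1,
      ← intervalIntegral.integral_const_mul]
    refine intervalIntegral_congr_Ioo fun s hs ↦ ?_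
    have hl := landen_integrand h0 h1 hk hs
    have hp : 0 < 1 + κ * s ^ 2 := by positivity
    have hκ : 1 + κ ≠ 0 := by positivity
    have h2 : 1 - k ^ 2 * ((1 + κ) * s / (1 + κ * s ^ 2)) ^ 2 =
        ((1 - κ * s ^ 2) / (1 + κ * s ^ 2)) ^ 2 := by
      rw [hk]
      field_simp
      ring
    rw [mul_left_comm ((1 + κ) * (1 - κ * s ^ 2) / (1 + κ * s ^ 2) ^ 2), hl, h2]
    field_simp
  have hR : 2 * ellipticE κ - (1 - κ ^ 2) * ellipticK κ = ∫ s in (0:ℝ)..1,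
      (2 * (1 - κ ^ 2 * s ^ 2) - (1 - κ ^ 2)) *
        (1 / √((1 - s ^ 2) * (1 - κ ^ 2 * s ^ 2))) := by
    rw [ellipticE_eq hκ2, ellipticK, ← intervalIntegral.integral_const_mul,
      ← intervalIntegral.integral_const_mul, ← intervalIntegral.integral_sub
      ((intervalIntegrable_mul_ellipticK hκ2 (by fun_prop)).const_mul _)
      ((intervalIntegrable_ellipticK hκ2).const_mul _)]
    congr 1 with s
    ring
  rw [hE, hR, ← sub_eq_zero, ← intervalIntegral.integral_sub
    (intervalIntegrable_mul_ellipticK hκ2 (hcont 2 _ (by fun_prop)))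
    (intervalIntegrable_mul_ellipticK hκ2 (by fun_prop))]
  trans 2 * κ * 0
  · have h00 : (0:ℝ) = 1 * √((1 - 1 ^ 2) * (1 - κ ^ 2 * 1 ^ 2)) / (1 + κ * 1 ^ 2) -
      0 * √((1 - 0 ^ 2) * (1 - κ ^ 2 * 0 ^ 2)) / (1 + κ * 0 ^ 2) := by simp
    conv_rhs => rw [h00, ← hprim, ← intervalIntegral.integral_const_mul]
    refine intervalIntegral_congr_Ioo fun s hs ↦ ?_
    have hp : 0 < 1 + κ * s ^ 2 := by positivity
    rw [← sub_mul, ← mul_assoc]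
    congr 1
    field_simp
    ring
  · simp

end EllipticIntegrals

section NomeTheta

open Set Filter Topology

/-- The theta constant `∑ q ^ (n ^ 2)`, summed over the integers, as a function of the real nome. -/
noncomputable def nomeTheta (q : ℝ) : ℝ := ∑' n : ℤ, q ^ (n.natAbs ^ 2)

lemma summable_pow_natAbs_sq {r : ℝ} (h0 : 0 ≤ r) (h1 : r < 1) :
    Summable fun n : ℤ ↦ r ^ (n.natAbs ^ 2) := by
  have h : Summable fun n : ℕ ↦ r ^ (n ^ 2) :=
    (summable_geometric_of_lt_one h0 h1).of_nonneg_of_le (fun n ↦ by positivity)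
      fun n ↦ pow_le_pow_of_le_one h0 h1.le (Nat.le_self_pow two_ne_zero n)
  exact Summable.of_nat_of_neg (by simpa using h) (by simpa using h)

lemma summable_nomeTheta {q : ℝ} (hq : |q| < 1) : Summable fun n : ℤ ↦ q ^ (n.natAbs ^ 2) := by
  refine Summable.of_norm ?_
  simpa using summable_pow_natAbs_sq (abs_nonneg q) hq

lemma nomeTheta_mul {p q : ℝ} (hp : |p| < 1) (hq : |q| < 1) :
    HasSum (fun x : ℤ × ℤ ↦ p ^ (x.1.natAbs ^ 2) * q ^ (x.2.natAbs ^ 2))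
      (nomeTheta p * nomeTheta q) := by
  have key : ∀ u : ℝ, |u| < 1 → Summable fun n : ℤ ↦ ‖u ^ (n.natAbs ^ 2)‖ := fun u hu ↦ by
    simpa using summable_pow_natAbs_sq (abs_nonneg u) hu
  have h := (summable_mul_of_summable_norm (key p hp) (key q hq)).hasSum
  rwa [← tsum_mul_tsum_of_summable_norm (key p hp) (key q hq)] at h

lemma neg_one_pow_natAbs_sq (n : ℤ) :
    (-1 : ℝ) ^ (n.natAbs ^ 2) = if Even n then 1 else -1 := by
  split_ifs with h
  · exact Even.neg_one_pow ((Int.natAbs_even.2 h).pow_of_ne_zero two_ne_zero)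
  · exact Odd.neg_one_pow ((Int.natAbs_odd.2 (Int.not_even_iff_odd.1 h)).pow)

lemma neg_pow_natAbs_sq (q : ℝ) (n : ℤ) :
    (-q) ^ (n.natAbs ^ 2) = (if Even n then 1 else -1) * q ^ (n.natAbs ^ 2) := by
  rw [neg_pow, neg_one_pow_natAbs_sq]

lemma pow_natAbs_add_mul_sub (q : ℝ) (a b : ℤ) :
    q ^ ((a + b).natAbs ^ 2) * q ^ ((a - b).natAbs ^ 2) =
      (q ^ 2) ^ (a.natAbs ^ 2) * (q ^ 2) ^ (b.natAbs ^ 2) := by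
  rw [← pow_add, ← pow_add, ← pow_mul]
  congr 1
  zify
  simp only [sq_abs]
  ring

lemma hasSum_comp_add_sub {g : ℤ × ℤ → ℝ} {s : ℝ} (hg : HasSum g s)
    (h0 : ∀ m n : ℤ, ¬ (Even m ↔ Even n) → g (m, n) = 0) :
    HasSum (fun x : ℤ × ℤ ↦ g (x.1 + x.2, x.1 - x.2)) s := by
  have hinj : Function.Injective fun x : ℤ × ℤ ↦ (x.1 + x.2, x.1 - x.2) := by
    rintro ⟨a, b⟩ ⟨c, d⟩ h
    simp only [Prod.mk.injEq] at h ⊢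
    omega
  refine (hinj.hasSum_iff fun ⟨m, n⟩ hmn ↦ h0 m n fun h ↦ hmn ?_).2 hg
  refine ⟨((m + n) / 2, (m - n) / 2), ?_⟩
  simp only [Int.even_iff] at h
  simp only [Prod.mk.injEq]
  omega

lemma abs_sq_lt_one {q : ℝ} (hq : |q| < 1) : |q ^ 2| < 1 := by
  rw [abs_pow]; exact pow_lt_one₀ (abs_nonneg _) hq two_ne_zero

lemma nomeTheta_sq_add_sq {q : ℝ} (hq : |q| < 1) :
    nomeTheta q ^ 2 + nomeTheta (-q) ^ 2 = 2 * nomeTheta (q ^ 2) ^ 2 := by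
  have hq' : |-q| < 1 := by rwa [abs_neg]
  have h := (nomeTheta_mul hq hq).add (nomeTheta_mul hq' hq')
  have h2 := (nomeTheta_mul (abs_sq_lt_one hq) (abs_sq_lt_one hq)).mul_left 2
  have h3 := hasSum_comp_add_sub h fun m n hmn ↦ by
    simp only [neg_pow_natAbs_sq]
    by_cases hm : Even m <;> by_cases hn : Even n <;> simp [hm, hn] at hmn ⊢
  simp only [sq (nomeTheta _)]
  refine h3.unique (h2.congr_fun fun ⟨a, b⟩ ↦ ?_)
  simp only [neg_pow_natAbs_sq, ← pow_natAbs_add_mul_sub, Int.even_add, Int.even_sub]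
  split_ifs <;> ring

lemma nomeTheta_mul_neg {q : ℝ} (hq : |q| < 1) :
    nomeTheta q * nomeTheta (-q) = nomeTheta (-q ^ 2) ^ 2 := by
  have hq' : |-q| < 1 := by rwa [abs_neg]
  have hq2 : |-q ^ 2| < 1 := by rw [abs_neg]; exact abs_sq_lt_one hq
  have h := (nomeTheta_mul hq hq').add (nomeTheta_mul hq' hq)
  have h2 := (nomeTheta_mul hq2 hq2).mul_left 2
  have h3 := hasSum_comp_add_sub h fun m n hmn ↦ by
    simp only [neg_pow_natAbs_sq]
    by_cases hm : Even m <;> by_cases hn : Even n <;> simp [hm, hn] at hmn ⊢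
  have h4 : nomeTheta q * nomeTheta (-q) + nomeTheta (-q) * nomeTheta q =
      2 * (nomeTheta (-q ^ 2) * nomeTheta (-q ^ 2)) := by
    refine h3.unique (h2.congr_fun fun ⟨a, b⟩ ↦ ?_)
    have := pow_natAbs_add_mul_sub q a b
    simp only [neg_pow_natAbs_sq, Int.even_add, Int.even_sub]
    by_cases ha : Even a <;> by_cases hb : Even b <;> simp [ha, hb] <;> linarith
  linarith

lemma nomeTheta_zero : nomeTheta 0 = 1 := by
  rw [nomeTheta, tsum_eq_single 0]
  · simp
  · intro n hn
    simp [hn]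

lemma one_le_nomeTheta {q : ℝ} (h0 : 0 ≤ q) (h1 : q < 1) : 1 ≤ nomeTheta q := by
  have := (summable_pow_natAbs_sq h0 h1).le_tsum 0 fun n _ ↦ by positivity
  simpa [nomeTheta] using this

lemma nomeTheta_neg_lt {q : ℝ} (h0 : 0 < q) (h1 : q < 1) : nomeTheta (-q) < nomeTheta q := by
  have h : |q| < 1 := by rwa [abs_of_pos h0]
  refine (summable_nomeTheta (by rwa [abs_neg])).tsum_lt_tsum (i := 1) (fun n ↦ ?_) ?_
    (summable_nomeTheta h)
  · rw [neg_pow_natAbs_sq]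
    have : 0 < q ^ (n.natAbs ^ 2) := by positivity
    split_ifs <;> linarith
  · simp; linarith

lemma ofReal_nomeTheta (q : ℝ) : (nomeTheta q : ℂ) = ∑' n : ℤ, (q : ℂ) ^ (n.natAbs ^ 2) := by
  rw [nomeTheta]; push_cast; rfl

lemma norm_pow_natAbs_sq_le {r : ℝ} {w : ℂ} (hw : w ∈ Metric.ball (0 : ℂ) r) (n : ℤ) :
    ‖w ^ (n.natAbs ^ 2)‖ ≤ r ^ (n.natAbs ^ 2) := by
  rw [norm_pow]
  exact pow_le_pow_left₀ (norm_nonneg _) (mem_ball_zero_iff.1 hw).le _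

lemma analyticAt_nomeTheta {q : ℝ} (hq : |q| < 1) : AnalyticAt ℝ nomeTheta q := by
  obtain ⟨r, hr, hr1⟩ := exists_between hq
  have hd : DifferentiableOn ℂ (fun w : ℂ ↦ ∑' n : ℤ, w ^ (n.natAbs ^ 2)) (Metric.ball 0 r) :=
    Complex.differentiableOn_tsum_of_summable_norm
      (summable_pow_natAbs_sq ((abs_nonneg q).trans hr.le) hr1)
      (fun n ↦ by fun_prop) Metric.isOpen_ball fun n w hw ↦ norm_pow_natAbs_sq_le hw n
  have ha := (hd.analyticAt (z := (q : ℂ))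
    (Metric.isOpen_ball.mem_nhds (by simpa using hr))).re_ofReal
  simpa only [← ofReal_nomeTheta, Complex.ofReal_re] using ha

lemma tendsto_nomeTheta_zero : Tendsto nomeTheta (𝓝 0) (𝓝 1) := by
  have := (analyticAt_nomeTheta (q := 0) (by simp)).continuousAt.tendsto
  rwa [nomeTheta_zero] at this

lemma deriv_nomeTheta_zero : deriv nomeTheta 0 = 2 := by
  have hs := summable_pow_natAbs_sq (r := 1 / 2) (by norm_num) (by norm_num)
  have h0 : (0 : ℂ) ∈ Metric.ball (0 : ℂ) (1 / 2) := by simp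
  have hd : DifferentiableOn ℂ (fun w : ℂ ↦ ∑' n : ℤ, w ^ (n.natAbs ^ 2))
      (Metric.ball 0 (1 / 2)) :=
    Complex.differentiableOn_tsum_of_summable_norm hs (fun n ↦ by fun_prop) Metric.isOpen_ball
      fun n w hw ↦ norm_pow_natAbs_sq_le hw n
  have hsum := Complex.hasSum_deriv_of_summable_norm hs (fun n ↦ by fun_prop) Metric.isOpen_ball
    (fun n w hw ↦ norm_pow_natAbs_sq_le hw n) h0
  have hval := hsum.unique (hasSum_sum_of_ne_finset_zero (s := {1, -1}) fun n hn ↦ ?_)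
  · have hda := (hd.differentiableAt (Metric.isOpen_ball.mem_nhds h0)).hasDerivAt
    rw [hval] at hda
    have := (HasDerivAt.real_of_complex (z := 0) (by simpa using hda)).deriv
    simpa [← ofReal_nomeTheta, one_add_one_eq_two] using! this
  · have hn2 : 1 < n.natAbs ^ 2 ∨ n = 0 := by
      by_cases h : n = 0
      · exact Or.inr h
      · left
        apply one_lt_pow₀ _ two_ne_zero
        simp at hn
        omega
    rcases hn2 with hn2 | rfl
    · simp
      omega
    · simp

lemma tendsto_pow_two_pow {q : ℝ} (hq : |q| < 1) :
    Tendsto (fun n : ℕ ↦ q ^ (2 ^ n)) atTop (𝓝 0) :=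
  (tendsto_pow_atTop_nhds_zero_of_abs_lt_one hq).comp
    (tendsto_pow_atTop_atTop_of_one_lt one_lt_two)

lemma nomeTheta_neg_pos {q : ℝ} (h0 : 0 < q) (h1 : q < 1) : 0 < nomeTheta (-q) := by
  have hfpos : ∀ n : ℕ, 0 < nomeTheta (q ^ (2 ^ n)) := fun n ↦ zero_lt_one.trans_le
    (one_le_nomeTheta (by positivity) (pow_lt_one₀ h0.le h1 (by positivity)))
  have habs : ∀ n : ℕ, |q ^ (2 ^ n)| < 1 := fun n ↦ by
    rw [abs_of_pos (by positivity)]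
    exact pow_lt_one₀ h0.le h1 (by positivity)
  have hm := nomeTheta_mul_neg (q := q) (by simpa using habs 0)
  have hpos : 0 < nomeTheta q := by simpa using hfpos 0
  have hnonneg : 0 ≤ nomeTheta (-q) := by
    by_contra! h
    nlinarith [mul_neg_of_pos_of_neg hpos h, sq_nonneg (nomeTheta (-q ^ 2))]
  refine hnonneg.lt_of_ne' fun hzero ↦ ?_
  have hall : ∀ n : ℕ, nomeTheta (-q ^ (2 ^ n)) = 0 := by
    intro n
    induction n with
    | zero => simpa using hzero
    | succ n ih =>
      have := nomeTheta_mul_neg (habs n)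
      rw [ih, mul_zero, ← pow_mul, ← pow_succ] at this
      exact pow_eq_zero_iff two_ne_zero |>.1 this.symm
  have hlim := tendsto_nomeTheta_zero.comp
    (neg_zero (G := ℝ) ▸ (tendsto_pow_two_pow (q := q) (by simpa using habs 0)).neg)
  simp only [Function.comp_def, hall] at hlim
  exact zero_ne_one (tendsto_nhds_unique tendsto_const_nhds hlim)

end NomeTheta

section NomeModulus

open Set Filter Topology

lemma eqOn_const_of_comp_sq {φ : ℝ → ℝ} {c : ℝ} (h : ∀ q ∈ Ioo (0:ℝ) 1, φ q = φ (q ^ 2))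
    (hlim : Tendsto φ (𝓝[>] 0) (𝓝 c)) {q : ℝ} (hq : q ∈ Ioo (0:ℝ) 1) : φ q = c := by
  have hpos : ∀ n : ℕ, 0 < q ^ (2 ^ n) := fun n ↦ pow_pos hq.1 _
  have hall : ∀ n : ℕ, φ (q ^ (2 ^ n)) = φ q := by
    intro n
    induction n with
    | zero => simp
    | succ n ih =>
      rw [← ih, h _ ⟨hpos n, pow_lt_one₀ hq.1.le hq.2 (by positivity)⟩, ← pow_mul, ← pow_succ]
  have ht := hlim.comp (tendsto_nhdsWithin_iff.2 ⟨tendsto_pow_two_pow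
    (by rw [abs_of_pos hq.1]; exact hq.2), .of_forall hpos⟩)
  simp only [Function.comp_def, hall] at ht
  exact tendsto_nhds_unique tendsto_const_nhds ht

lemma tendsto_mul_log_zero {h : ℝ → ℝ} (hd : DifferentiableAt ℝ h 0) (h0 : h 0 = 0) :
    Tendsto (fun q ↦ h q * log q) (𝓝[>] 0) (𝓝 0) := by
  have hs := (hasDerivAt_iff_tendsto_slope.1 hd.hasDerivAt).mono_left
    (nhdsWithin_mono 0 fun x (hx : x ∈ Ioi 0) ↦ hx.ne')
  have hl : Tendsto (fun q : ℝ ↦ q * log q) (𝓝[>] 0) (𝓝 0) := by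
    simpa using continuous_mul_log.tendsto' 0 0 (by simp) |>.mono_left nhdsWithin_le_nhds
  have := hs.mul hl
  rw [mul_zero] at this
  refine this.congr' ?_
  filter_upwards [self_mem_nhdsWithin] with q (hq : 0 < q)
  rw [slope_def_field, h0]
  have := hq.ne'
  field_simp
  ring

/-- The elliptic modulus attached to the nome `q`. -/
noncomputable def nomeModulus (q : ℝ) : ℝ := √(1 - nomeTheta (-q) ^ 4 / nomeTheta q ^ 4)

variable {q : ℝ}

lemma abs_lt_one_of_mem_Ioo (hq : q ∈ Ioo (0:ℝ) 1) : |q| < 1 := by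
  rw [abs_of_pos hq.1]; exact hq.2

lemma sq_mem_Ioo (hq : q ∈ Ioo (0:ℝ) 1) : q ^ 2 ∈ Ioo (0:ℝ) 1 :=
  ⟨pow_pos hq.1 2, pow_lt_one₀ hq.1.le hq.2 two_ne_zero⟩

lemma nomeTheta_pos (hq : q ∈ Ioo (0:ℝ) 1) : 0 < nomeTheta q :=
  zero_lt_one.trans_le (one_le_nomeTheta hq.1.le hq.2)

lemma nomeTheta_neg_sq_lt (hq : q ∈ Ioo (0:ℝ) 1) : nomeTheta (-q) ^ 2 < nomeTheta q ^ 2 :=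
  pow_lt_pow_left₀ (nomeTheta_neg_lt hq.1 hq.2) (nomeTheta_neg_pos hq.1 hq.2).le two_ne_zero

lemma nomeTheta_neg_pow_four_lt (hq : q ∈ Ioo (0:ℝ) 1) :
    nomeTheta (-q) ^ 4 < nomeTheta q ^ 4 :=
  pow_lt_pow_left₀ (nomeTheta_neg_lt hq.1 hq.2) (nomeTheta_neg_pos hq.1 hq.2).le four_ne_zero

lemma nomeModulus_sq (hq : q ∈ Ioo (0:ℝ) 1) :
    nomeModulus q ^ 2 = 1 - nomeTheta (-q) ^ 4 / nomeTheta q ^ 4 := by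
  refine sq_sqrt (sub_nonneg.2 ?_)
  rw [div_le_one (pow_pos (nomeTheta_pos hq) 4)]
  exact (nomeTheta_neg_pow_four_lt hq).le

lemma nomeModulus_nonneg : 0 ≤ nomeModulus q := sqrt_nonneg _

lemma nomeModulus_sq_lt_one (hq : q ∈ Ioo (0:ℝ) 1) : nomeModulus q ^ 2 < 1 := by
  rw [nomeModulus_sq hq]
  have := nomeTheta_pos hq
  have := nomeTheta_neg_pos hq.1 hq.2
  simp only [sub_lt_self_iff]
  positivity

lemma nomeModulus_mem_Ioo (hq : q ∈ Ioo (0:ℝ) 1) : nomeModulus q ∈ Ioo (0:ℝ) 1 := by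
  refine ⟨sqrt_pos.2 (sub_pos.2 ?_), ?_⟩
  · rw [div_lt_one (pow_pos (nomeTheta_pos hq) 4)]
    exact nomeTheta_neg_pow_four_lt hq
  · exact (sq_lt_one_iff₀ nomeModulus_nonneg).1 (nomeModulus_sq_lt_one hq)

lemma nomeModulus_comp_sq (hq : q ∈ Ioo (0:ℝ) 1) :
    nomeModulus (q ^ 2) = (nomeTheta q ^ 2 - nomeTheta (-q) ^ 2) /
      (nomeTheta q ^ 2 + nomeTheta (-q) ^ 2) := by
  have hF := nomeTheta_pos hq
  have hM := nomeTheta_neg_pos hq.1 hq.2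
  have h1 := nomeTheta_sq_add_sq (abs_lt_one_of_mem_Ioo hq)
  have h2 := nomeTheta_mul_neg (abs_lt_one_of_mem_Ioo hq)
  have h3 := nomeTheta_neg_sq_lt hq
  refine (pow_left_inj₀ nomeModulus_nonneg (div_nonneg (by linarith) (by positivity))
    two_ne_zero).1 ?_
  have h4 : nomeTheta (q ^ 2) ^ 4 = ((nomeTheta q ^ 2 + nomeTheta (-q) ^ 2) / 2) ^ 2 := by
    rw [h1]; ring
  have h5 : nomeTheta (-q ^ 2) ^ 4 = (nomeTheta q * nomeTheta (-q)) ^ 2 := by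
    rw [h2]; ring
  rw [nomeModulus_sq (sq_mem_Ioo hq), h4, h5]
  field_simp
  ring

lemma one_add_nomeModulus_comp_sq (hq : q ∈ Ioo (0:ℝ) 1) :
    1 + nomeModulus (q ^ 2) = nomeTheta q ^ 2 / nomeTheta (q ^ 2) ^ 2 := by
  have hF := nomeTheta_pos hq
  have hF2 := nomeTheta_pos (sq_mem_Ioo hq)
  have h1 := nomeTheta_sq_add_sq (abs_lt_one_of_mem_Ioo hq)
  rw [nomeModulus_comp_sq hq, h1]
  field_simp
  linarith

lemma nomeModulus_landen (hq : q ∈ Ioo (0:ℝ) 1) :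
    nomeModulus q ^ 2 = 4 * nomeModulus (q ^ 2) / (1 + nomeModulus (q ^ 2)) ^ 2 := by
  have hF := nomeTheta_pos hq
  rw [nomeModulus_sq hq, nomeModulus_comp_sq hq]
  have : 1 + (nomeTheta q ^ 2 - nomeTheta (-q) ^ 2) / (nomeTheta q ^ 2 + nomeTheta (-q) ^ 2) =
      2 * nomeTheta q ^ 2 / (nomeTheta q ^ 2 + nomeTheta (-q) ^ 2) := by
    field_simp
    ring
  rw [this]
  field_simp
  ring

lemma tendsto_nomeTheta_nhdsGT : Tendsto nomeTheta (𝓝[>] 0) (𝓝 1) :=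
  tendsto_nomeTheta_zero.mono_left nhdsWithin_le_nhds

lemma tendsto_nomeTheta_neg_nhdsGT : Tendsto (fun q ↦ nomeTheta (-q)) (𝓝[>] 0) (𝓝 1) :=
  (tendsto_nomeTheta_zero.comp (continuous_neg.tendsto' (0:ℝ) 0 neg_zero)).mono_left
    nhdsWithin_le_nhds

lemma Ioo_mem_nhdsGT_zero : Ioo (0:ℝ) 1 ∈ 𝓝[>] (0:ℝ) := Ioo_mem_nhdsGT zero_lt_one

lemma one_div_one_sub_nomeModulus_sq (hq : q ∈ Ioo (0:ℝ) 1) (c : ℝ) :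
    c / (1 - nomeModulus q ^ 2) = c * (nomeTheta q ^ 4 / nomeTheta (-q) ^ 4) := by
  rw [nomeModulus_sq hq, sub_sub_cancel, div_div_eq_mul_div, mul_div_assoc]

/-- Jacobi's evaluation of the complete elliptic integral of the first kind. -/
theorem ellipticK_nomeModulus (hq : q ∈ Ioo (0:ℝ) 1) :
    ellipticK (nomeModulus q) = π / 2 * nomeTheta q ^ 2 := by
  have hF := nomeTheta_pos hq
  rw [← div_eq_iff (by positivity)]
  refine eqOn_const_of_comp_sq (φ := fun q ↦ ellipticK (nomeModulus q) / nomeTheta q ^ 2)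
    (fun q hq ↦ ?_) ?_ hq
  · have hF := nomeTheta_pos hq
    rw [ellipticK_landen nomeModulus_nonneg (nomeModulus_mem_Ioo (sq_mem_Ioo hq)).2
      (nomeModulus_landen hq), one_add_nomeModulus_comp_sq hq]
    field_simp
  · have hK : Tendsto (fun q ↦ ellipticK (nomeModulus q)) (𝓝[>] 0) (𝓝 (π / 2)) := by
      refine tendsto_of_tendsto_of_tendsto_of_le_of_le' tendsto_const_nhds
        (h := fun q ↦ π / 2 * (nomeTheta q ^ 4 / nomeTheta (-q) ^ 4)) ?_ ?_ ?_
      · simpa using ((tendsto_nomeTheta_nhdsGT.pow 4).div (tendsto_nomeTheta_neg_nhdsGT.pow 4)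
          (by simp)).const_mul (π / 2)
      · filter_upwards [Ioo_mem_nhdsGT_zero] with q hq
        exact pi_div_two_le_ellipticK (nomeModulus_sq_lt_one hq)
      · filter_upwards [Ioo_mem_nhdsGT_zero] with q hq
        rw [← one_div_one_sub_nomeModulus_sq hq]
        exact ellipticK_le (nomeModulus_sq_lt_one hq)
    simpa using! hK.div (tendsto_nomeTheta_nhdsGT.pow 2) (by simp)

lemma hasDerivAt_nomeTheta (hq : |q| < 1) : HasDerivAt nomeTheta (deriv nomeTheta q) q :=
  (analyticAt_nomeTheta hq).differentiableAt.hasDerivAt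

lemma hasDerivAt_nomeTheta_neg (hq : |q| < 1) :
    HasDerivAt (fun q ↦ nomeTheta (-q)) (-deriv nomeTheta (-q)) q := by
  simpa using! (hasDerivAt_nomeTheta (q := -q) (by rwa [abs_neg])).comp q (hasDerivAt_neg q)

lemma HasDerivAt.comp_sq {f : ℝ → ℝ} {f' x : ℝ} (h : HasDerivAt f f' (x ^ 2)) :
    HasDerivAt (fun y ↦ f (y ^ 2)) (f' * (2 * x)) x := by
  have hp : HasDerivAt (fun y : ℝ ↦ y ^ 2) (2 * x) x := by simpa using hasDerivAt_pow 2 x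
  exact HasDerivAt.comp (h₂ := f) x h hp

lemma deriv_nomeTheta_sq_add_sq (hq : |q| < 1) :
    nomeTheta q * deriv nomeTheta q - nomeTheta (-q) * deriv nomeTheta (-q) =
      4 * q * nomeTheta (q ^ 2) * deriv nomeTheta (q ^ 2) := by
  have h1 := ((hasDerivAt_nomeTheta hq).fun_pow 2).fun_add ((hasDerivAt_nomeTheta_neg hq).fun_pow 2)
  have h2 := ((hasDerivAt_nomeTheta (abs_sq_lt_one hq)).comp_sq.fun_pow 2).const_mul 2
  have h3 : (fun q ↦ nomeTheta q ^ 2 + nomeTheta (-q) ^ 2) =ᶠ[𝓝 q]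
      fun q ↦ 2 * nomeTheta (q ^ 2) ^ 2 := by
    filter_upwards [continuous_abs.continuousAt.eventually_lt continuousAt_const hq] with p hp
    exact nomeTheta_sq_add_sq hp
  have h4 := h1.unique (h2.congr_of_eventuallyEq h3)
  simp at h4
  linarith

lemma deriv_nomeTheta_mul_neg (hq : |q| < 1) :
    nomeTheta q * deriv nomeTheta (-q) - nomeTheta (-q) * deriv nomeTheta q =
      4 * q * nomeTheta (-q ^ 2) * deriv nomeTheta (-q ^ 2) := by
  have h1 := (hasDerivAt_nomeTheta hq).fun_mul (hasDerivAt_nomeTheta_neg hq)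
  have h2 := (hasDerivAt_nomeTheta_neg (abs_sq_lt_one hq)).comp_sq.fun_pow 2
  have h3 : (fun q ↦ nomeTheta q * nomeTheta (-q)) =ᶠ[𝓝 q]
      fun q ↦ nomeTheta (-q ^ 2) ^ 2 := by
    filter_upwards [continuous_abs.continuousAt.eventually_lt continuousAt_const hq] with p hp
    exact nomeTheta_mul_neg hp
  have h4 := h1.unique (h2.congr_of_eventuallyEq h3)
  simp at h4
  linarith

lemma tendsto_deriv_nomeTheta_zero : Tendsto (deriv nomeTheta) (𝓝 0) (𝓝 2) := by
  have := (analyticAt_nomeTheta (q := 0) (by simp)).deriv.continuousAt.tendsto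
  rwa [deriv_nomeTheta_zero] at this

/-- The differential equation `dk'/k' = -(k² / 2) θ₃⁴ dq/q` in terms of theta constants. -/
theorem logDeriv_nomeTheta_add_neg (hq : q ∈ Ioo (0:ℝ) 1) :
    q * (deriv nomeTheta q / nomeTheta q + deriv nomeTheta (-q) / nomeTheta (-q)) =
      1 / 4 * (nomeTheta q ^ 4 - nomeTheta (-q) ^ 4) := by
  rw [← div_eq_iff (sub_pos.2 (nomeTheta_neg_pow_four_lt hq)).ne']
  refine eqOn_const_of_comp_sq (φ := fun q ↦
    q * (deriv nomeTheta q / nomeTheta q + deriv nomeTheta (-q) / nomeTheta (-q)) /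
      (nomeTheta q ^ 4 - nomeTheta (-q) ^ 4)) (fun q hq ↦ ?_) ?_ hq
  · have hF := nomeTheta_pos hq
    have hM := nomeTheta_neg_pos hq.1 hq.2
    have hF2 := nomeTheta_pos (sq_mem_Ioo hq)
    have hM2 := nomeTheta_neg_pos (sq_mem_Ioo hq).1 (sq_mem_Ioo hq).2
    have h1 := nomeTheta_sq_add_sq (abs_lt_one_of_mem_Ioo hq)
    have h2 := nomeTheta_mul_neg (abs_lt_one_of_mem_Ioo hq)
    have h3 := nomeTheta_neg_sq_lt hq
    have d1 := deriv_nomeTheta_sq_add_sq (abs_lt_one_of_mem_Ioo hq)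
    have d2 := deriv_nomeTheta_mul_neg (abs_lt_one_of_mem_Ioo hq)
    have hq0 := hq.1
    have e1 : q ^ 2 * (deriv nomeTheta (q ^ 2) / nomeTheta (q ^ 2)) =
        q * (nomeTheta q * deriv nomeTheta q - nomeTheta (-q) * deriv nomeTheta (-q)) /
          (2 * (nomeTheta q ^ 2 + nomeTheta (-q) ^ 2)) := by
      rw [d1, h1]
      field_simp
      ring
    have e2 : q ^ 2 * (deriv nomeTheta (-q ^ 2) / nomeTheta (-q ^ 2)) =
        q * (nomeTheta q * deriv nomeTheta (-q) - nomeTheta (-q) * deriv nomeTheta q) /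
          (4 * (nomeTheta q * nomeTheta (-q))) := by
      rw [d2, h2]
      field_simp
    have e3 : nomeTheta (q ^ 2) ^ 4 - nomeTheta (-q ^ 2) ^ 4 =
        (nomeTheta q ^ 2 - nomeTheta (-q) ^ 2) ^ 2 / 4 := by
      have h4 : nomeTheta (q ^ 2) ^ 4 = ((nomeTheta q ^ 2 + nomeTheta (-q) ^ 2) / 2) ^ 2 := by
        rw [h1]; ring
      have h5 : nomeTheta (-q ^ 2) ^ 4 = (nomeTheta q * nomeTheta (-q)) ^ 2 := by
        rw [h2]; ring
      rw [h4, h5]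
      ring
    have e4 : nomeTheta q ^ 4 - nomeTheta (-q) ^ 4 =
        (nomeTheta q ^ 2 - nomeTheta (-q) ^ 2) * (nomeTheta q ^ 2 + nomeTheta (-q) ^ 2) := by
      ring
    have h6 : nomeTheta q ^ 2 - nomeTheta (-q) ^ 2 ≠ 0 := (sub_pos.2 h3).ne'
    rw [mul_add (q ^ 2), e1, e2, e3, e4]
    generalize nomeTheta q = F at *
    generalize nomeTheta (-q) = M at *
    have h7 : F ^ 2 + M ^ 2 ≠ 0 := by positivity
    field_simp
    ring
  · have hF := tendsto_nomeTheta_nhdsGT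
    have hM := tendsto_nomeTheta_neg_nhdsGT
    have hdF : Tendsto (deriv nomeTheta) (𝓝[>] 0) (𝓝 2) :=
      tendsto_deriv_nomeTheta_zero.mono_left nhdsWithin_le_nhds
    have hdM : Tendsto (fun q ↦ deriv nomeTheta (-q)) (𝓝[>] 0) (𝓝 2) :=
      (tendsto_deriv_nomeTheta_zero.comp (continuous_neg.tendsto' (0:ℝ) 0 neg_zero)).mono_left
        nhdsWithin_le_nhds
    have h0 : |(0 : ℝ)| < 1 := by simp
    have hden : HasDerivAt (fun q ↦ nomeTheta q ^ 4 - nomeTheta (-q) ^ 4) 16 0 := by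
      refine (((hasDerivAt_nomeTheta h0).fun_pow 4).fun_sub
        ((hasDerivAt_nomeTheta_neg h0).fun_pow 4)).congr_deriv ?_
      simp [deriv_nomeTheta_zero, nomeTheta_zero]
      norm_num
    have hs := (hasDerivAt_iff_tendsto_slope.1 hden).mono_left
      (nhdsWithin_mono 0 fun x (hx : x ∈ Ioi 0) ↦ hx.ne')
    have := ((hdF.div hF one_ne_zero).add (hdM.div hM one_ne_zero)).div hs (by norm_num)
    rw [show (1 / 4 : ℝ) = (2 / 1 + 2 / 1) / 16 by norm_num]
    refine this.congr' ?_
    filter_upwards [Ioo_mem_nhdsGT_zero] with q hq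
    have hq0 := hq.1.ne'
    simp only [Pi.div_apply, slope_def_field, neg_zero, sub_self, sub_zero]
    field_simp

/-- Jacobi's evaluation of the complete elliptic integral of the second kind. -/
theorem ellipticE_nomeModulus (hq : q ∈ Ioo (0:ℝ) 1) :
    6 / π * nomeTheta q ^ 2 * ellipticE (nomeModulus q) =
      12 * (q * deriv nomeTheta q / nomeTheta q) + 3 * nomeTheta (-q) ^ 4 := by
  have hlog : log q ≠ 0 := (log_neg hq.1 hq.2).ne
  rw [← sub_eq_zero]
  refine (mul_eq_zero.1 ?_).resolve_right hlog
  refine eqOn_const_of_comp_sq (φ := fun q ↦ (6 / π * nomeTheta q ^ 2 * ellipticE (nomeModulus q)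
    - (12 * (q * deriv nomeTheta q / nomeTheta q) + 3 * nomeTheta (-q) ^ 4)) * log q)
    (fun q hq ↦ ?_) ?_ hq
  · have hF := nomeTheta_pos hq
    have hM := nomeTheta_neg_pos hq.1 hq.2
    have hF2 := nomeTheta_pos (sq_mem_Ioo hq)
    have h1 := nomeTheta_sq_add_sq (abs_lt_one_of_mem_Ioo hq)
    have h2 := nomeTheta_mul_neg (abs_lt_one_of_mem_Ioo hq)
    have d1 := deriv_nomeTheta_sq_add_sq (abs_lt_one_of_mem_Ioo hq)
    have hL := ellipticE_landen nomeModulus_nonneg (nomeModulus_mem_Ioo (sq_mem_Ioo hq)).2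
      (nomeModulus_landen hq)
    have hv := logDeriv_nomeTheta_add_neg hq
    have hq0 := hq.1
    have e1 : q ^ 2 * deriv nomeTheta (q ^ 2) / nomeTheta (q ^ 2) =
        q * (nomeTheta q * deriv nomeTheta q - nomeTheta (-q) * deriv nomeTheta (-q)) /
          (2 * (nomeTheta q ^ 2 + nomeTheta (-q) ^ 2)) := by
      rw [d1, h1]
      field_simp
      ring
    have h5 : nomeTheta (-q ^ 2) ^ 4 = (nomeTheta q * nomeTheta (-q)) ^ 2 := by
      rw [h2]; ring
    have hG : 6 / π * nomeTheta q ^ 2 * ellipticE (nomeModulus q) =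
        2 * (6 / π * nomeTheta (q ^ 2) ^ 2 * ellipticE (nomeModulus (q ^ 2))) -
          3 * (nomeTheta q * nomeTheta (-q)) ^ 2 := by
      rw [one_add_nomeModulus_comp_sq hq, ellipticK_nomeModulus (sq_mem_Ioo hq),
        nomeModulus_sq (sq_mem_Ioo hq), h5] at hL
      field_simp at hL ⊢
      linarith
    have hR : 12 * (q * deriv nomeTheta q / nomeTheta q) + 3 * nomeTheta (-q) ^ 4 =
        2 * (12 * (q ^ 2 * deriv nomeTheta (q ^ 2) / nomeTheta (q ^ 2)) +
          3 * nomeTheta (-q ^ 2) ^ 4) - 3 * (nomeTheta q * nomeTheta (-q)) ^ 2 := by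
      rw [h5, e1]
      generalize nomeTheta q = F at *
      generalize nomeTheta (-q) = M at *
      have h7 : F ^ 2 + M ^ 2 ≠ 0 := by positivity
      field_simp at hv ⊢
      linear_combination (3 * M) * hv
    rw [hG, hR, log_pow]
    push_cast
    ring
  · have h0 : |(0 : ℝ)| < 1 := by simp
    have dF : DifferentiableAt ℝ nomeTheta 0 := (hasDerivAt_nomeTheta h0).differentiableAt
    have dM : DifferentiableAt ℝ (fun q ↦ nomeTheta (-q)) 0 :=
      (hasDerivAt_nomeTheta_neg h0).differentiableAt
    have dd : DifferentiableAt ℝ (deriv nomeTheta) 0 :=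
      (analyticAt_nomeTheta h0).deriv.differentiableAt
    have hne : nomeTheta 0 ≠ 0 := by simp [nomeTheta_zero]
    have hne' : nomeTheta (-0) ≠ 0 := by simp [nomeTheta_zero]
    have dR : DifferentiableAt ℝ (fun q ↦ 12 * (q * deriv nomeTheta q / nomeTheta q) +
        3 * nomeTheta (-q) ^ 4) 0 :=
      (((differentiableAt_id.fun_mul dd).fun_div dF hne).const_mul 12).fun_add
        ((dM.fun_pow 4).const_mul 3)
    refine tendsto_of_tendsto_of_tendsto_of_le_of_le'
      (tendsto_mul_log_zero (((((dF.fun_pow 6).fun_div (dM.fun_pow 4)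
        (pow_ne_zero 4 hne')).const_mul
        3).fun_sub dR)) (by simp [nomeTheta_zero]))
      (tendsto_mul_log_zero (((((dM.fun_pow 4).fun_div (dF.fun_pow 2) (pow_ne_zero 2 hne)).const_mul
        3).fun_sub dR)) (by simp [nomeTheta_zero])) ?_ ?_
    · filter_upwards [Ioo_mem_nhdsGT_zero] with q hq
      have hF := nomeTheta_pos hq
      have h := ellipticE_le (nomeModulus_sq_lt_one hq)
      rw [one_div_one_sub_nomeModulus_sq hq] at h
      refine mul_le_mul_of_nonpos_right (sub_le_sub_right ?_ _) (log_neg hq.1 hq.2).le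
      refine (mul_le_mul_of_nonneg_left h (by positivity)).trans_eq ?_
      field_simp
      norm_num
    · filter_upwards [Ioo_mem_nhdsGT_zero] with q hq
      have hF := nomeTheta_pos hq
      have h := le_ellipticE (nomeModulus_sq_lt_one hq)
      rw [nomeModulus_sq hq, sub_sub_cancel] at h
      refine mul_le_mul_of_nonpos_right (sub_le_sub_right ?_ _) (log_neg hq.1 hq.2).le
      refine (mul_le_mul_of_nonneg_left h (by positivity)).trans_eq' ?_
      field_simp
      ring

end NomeModulus

section Inversion

open Set Filter Topology HurwitzZeta

variable {x : ℝ}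

lemma exp_neg_pi_mul_mem_Ioo (hx : 0 < x) : rexp (-π * x) ∈ Ioo (0:ℝ) 1 :=
  ⟨exp_pos _, exp_lt_one_iff.2 (by nlinarith [pi_pos])⟩

lemma exp_neg_pi_mul_two_mul (x : ℝ) : rexp (-π * (2 * x)) = rexp (-π * x) ^ 2 := by
  rw [← exp_nat_mul]
  push_cast
  ring_nf

lemma exp_neg_pi_mul_pow_natAbs_sq (x : ℝ) (n : ℤ) :
    rexp (-π * x) ^ (n.natAbs ^ 2) = rexp (-π * n ^ 2 * x) := by
  rw [← exp_nat_mul]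
  have : ((n.natAbs ^ 2 : ℕ) : ℝ) = (n : ℝ) ^ 2 := by
    rw [← Int.cast_natCast]
    simp
  rw [this]
  ring_nf

lemma nomeTheta_exp (hx : 0 < x) : nomeTheta (rexp (-π * x)) = evenKernel 0 x := by
  have h := hasSum_int_evenKernel 0 hx
  rw [QuotientAddGroup.mk_zero] at h
  refine (summable_nomeTheta (abs_lt_one_of_mem_Ioo (exp_neg_pi_mul_mem_Ioo hx))).hasSum.unique
    (h.congr_fun fun n ↦ ?_)
  rw [exp_neg_pi_mul_pow_natAbs_sq, add_zero]

lemma nomeTheta_neg_exp (hx : 0 < x) :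
    nomeTheta (-rexp (-π * x)) = cosKernel ((1 / 2 : ℝ) : UnitAddCircle) x := by
  have hs := summable_nomeTheta (q := -rexp (-π * x))
    (by rw [abs_neg]; exact abs_lt_one_of_mem_Ioo (exp_neg_pi_mul_mem_Ioo hx))
  apply Complex.ofReal_injective
  refine (Complex.hasSum_ofReal.2 hs.hasSum).unique
    ((hasSum_int_cosKernel (1 / 2) hx).congr_fun fun n ↦ ?_)
  rw [neg_pow_natAbs_sq, exp_neg_pi_mul_pow_natAbs_sq, Complex.ofReal_mul]
  congr 1
  have h1 : Complex.exp (2 * π * Complex.I * ((1 / 2 : ℝ) : ℂ) * n) = (-1) ^ n := by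
    rw [← Complex.exp_pi_mul_I, ← Complex.exp_int_mul]
    congr 1
    push_cast
    ring
  rw [h1]
  split_ifs with hn
  · rw [hn.neg_one_zpow]; simp
  · rw [(Int.not_even_iff_odd.1 hn).neg_one_zpow]; simp

lemma nomeTheta_exp_inv (hx : 0 < x) :
    nomeTheta (rexp (-π * (1 / x))) = √x * nomeTheta (rexp (-π * x)) := by
  rw [nomeTheta_exp hx, nomeTheta_exp (by positivity), evenKernel_functional_equation,
    ← evenKernel_eq_cosKernel_of_zero, one_div_one_div, ← sqrt_eq_rpow, sqrt_div zero_le_one]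
  simp

lemma nomeTheta_neg_exp_inv (hx : 0 < x) :
    nomeTheta (-rexp (-π * (1 / x))) = √x * evenKernel ((1 / 2 : ℝ) : UnitAddCircle) x := by
  rw [nomeTheta_neg_exp (by positivity), evenKernel_functional_equation, ← sqrt_eq_rpow,
    ← mul_assoc, mul_one_div_cancel (sqrt_pos.2 hx).ne', one_mul]

/-- Jacobi's quartic identity for theta constants. -/
theorem nomeTheta_pow_four (hx : 0 < x) :
    nomeTheta (rexp (-π * x)) ^ 4 = nomeTheta (-rexp (-π * x)) ^ 4 +
      evenKernel ((1 / 2 : ℝ) : UnitAddCircle) x ^ 4 := by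
  have hx2 : 0 < x / 2 := by positivity
  have habs : ∀ {y : ℝ}, 0 < y → |rexp (-π * y)| < 1 := fun hy ↦
    abs_lt_one_of_mem_Ioo (exp_neg_pi_mul_mem_Ioo hy)
  have h1 := nomeTheta_sq_add_sq (habs (one_div_pos.2 hx))
  rw [← exp_neg_pi_mul_two_mul, show 2 * (1 / x) = 1 / (x / 2) by field_simp,
    nomeTheta_exp_inv hx, nomeTheta_neg_exp_inv hx, nomeTheta_exp_inv hx2, mul_pow, mul_pow,
    mul_pow, sq_sqrt hx.le, sq_sqrt hx2.le] at h1
  have h2 := nomeTheta_sq_add_sq (habs hx2)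
  have h3 := nomeTheta_mul_neg (habs hx2)
  rw [← exp_neg_pi_mul_two_mul, mul_div_cancel₀ _ two_ne_zero] at h2 h3
  have h4 : nomeTheta (rexp (-π * x)) ^ 2 + evenKernel ((1 / 2 : ℝ) : UnitAddCircle) x ^ 2 =
      nomeTheta (rexp (-π * (x / 2))) ^ 2 := by
    apply mul_left_cancel₀ hx.ne'
    linarith
  have h5 : nomeTheta (rexp (-π * x)) ^ 2 - evenKernel ((1 / 2 : ℝ) : UnitAddCircle) x ^ 2 =
      nomeTheta (-rexp (-π * (x / 2))) ^ 2 := by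
    linarith
  have h6 : nomeTheta (-rexp (-π * x)) ^ 4 =
      (nomeTheta (rexp (-π * (x / 2))) * nomeTheta (-rexp (-π * (x / 2)))) ^ 2 := by
    rw [h3]; ring
  rw [h6, mul_pow, ← h4, ← h5]
  ring

lemma xRatio_nomeModulus (hx : 0 < x) : xRatio (nomeModulus (rexp (-π * x))) = x := by
  have hq := exp_neg_pi_mul_mem_Ioo hx
  have hq' := exp_neg_pi_mul_mem_Ioo (one_div_pos.2 hx)
  have hF := nomeTheta_pos hq
  have hk : √(1 - nomeModulus (rexp (-π * x)) ^ 2) = nomeModulus (rexp (-π * (1 / x))) := by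
    rw [nomeModulus_sq hq, nomeModulus, nomeTheta_exp_inv hx, nomeTheta_neg_exp_inv hx, mul_pow,
      mul_pow, mul_div_mul_left _ _ (pow_pos (sqrt_pos.2 hx) 4).ne', nomeTheta_pow_four hx]
    congr 1
    have := nomeTheta_pow_four hx
    have h4 : 0 < nomeTheta (rexp (-π * x)) ^ 4 := by positivity
    rw [this] at h4
    rw [sub_sub_cancel, one_sub_div h4.ne', add_sub_cancel_right]
  rw [xRatio, hk, ellipticK_nomeModulus hq, ellipticK_nomeModulus hq', nomeTheta_exp_inv hx,
    mul_pow, sq_sqrt hx.le, mul_left_comm, mul_div_cancel_right₀ _ (by positivity)]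

lemma xRatio_pos {k : ℝ} (hk : k ∈ Ioo (0:ℝ) 1) : 0 < xRatio k := by
  have hk2 : k ^ 2 < 1 := by nlinarith [hk.1, hk.2]
  refine div_pos (ellipticK_pos ?_) (ellipticK_pos hk2)
  rw [sq_sqrt (by linarith)]
  linarith [pow_pos hk.1 2]

lemma nomeModulus_exp_xRatio {k : ℝ} (hk : k ∈ Ioo (0:ℝ) 1) :
    nomeModulus (rexp (-π * xRatio k)) = k :=
  xRatio_injOn (nomeModulus_mem_Ioo (exp_neg_pi_mul_mem_Ioo (xRatio_pos hk))) hk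
    (xRatio_nomeModulus (xRatio_pos hk))

end Inversion

section ThetaDiscriminant

open Set Filter Topology UpperHalfPlane ModularForm MatrixGroups

lemma jacobiTheta₂_add_one_right (z τ : ℂ) :
    jacobiTheta₂ z (τ + 1) = jacobiTheta₂ (z + 1 / 2) τ := by
  refine tsum_congr fun n ↦ ?_
  simp only [jacobiTheta₂_term]
  rw [Complex.exp_eq_exp_iff_exists_int]
  obtain ⟨m, hm⟩ := Int.even_mul_succ_self (n - 1)
  refine ⟨m, ?_⟩
  have h : (n : ℂ) * (n - 1) = 2 * m := by
    have : n * (n - 1) = 2 * m := by linarith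
    exact_mod_cast congrArg (Int.cast (R := ℂ)) this
  linear_combination π * Complex.I * h

/-- The eighth power of the product of the three theta constants. -/
noncomputable def thetaProduct (τ : ℂ) : ℂ :=
  Complex.exp (2 * π * Complex.I * τ) *
    (jacobiTheta₂ (τ / 2) τ * jacobiTheta₂ 0 τ * jacobiTheta₂ (1 / 2) τ) ^ 8

lemma thetaProduct_add_one (τ : ℂ) : thetaProduct (τ + 1) = thetaProduct τ := by
  have h1 : jacobiTheta₂ ((τ + 1) / 2) (τ + 1) = jacobiTheta₂ (τ / 2) τ := by
    rw [jacobiTheta₂_add_one_right, show (τ + 1) / 2 + 1 / 2 = τ / 2 + 1 by ring,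
      jacobiTheta₂_add_left]
  have h2 : jacobiTheta₂ (1 / 2) (τ + 1) = jacobiTheta₂ 0 τ := by
    rw [jacobiTheta₂_add_one_right, show (1 / 2 + 1 / 2 : ℂ) = 0 + 1 by norm_num,
      jacobiTheta₂_add_left]
  rw [thetaProduct, h1, h2, jacobiTheta₂_add_one_right, zero_add, thetaProduct, mul_add, mul_one,
    Complex.exp_add, Complex.exp_two_pi_mul_I]
  ring

lemma thetaProduct_neg_inv {τ : ℂ} (hτ : τ ≠ 0) :
    thetaProduct (-1 / τ) = τ ^ 12 * thetaProduct τ := by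
  set s : ℂ := (-Complex.I * τ) ^ (1 / 2 : ℂ) with hs
  have hs2 : s ^ 2 = -Complex.I * τ := by
    rw [hs, ← Complex.cpow_nat_mul]
    simp
  have hs0 : s ≠ 0 := by
    intro h
    rw [h] at hs2
    simp [hτ] at hs2
  have hb : jacobiTheta₂ 0 (-1 / τ) = s * jacobiTheta₂ 0 τ := by
    rw [jacobiTheta₂_functional_equation 0 τ, ← hs]
    simp
    field_simp
  have hc : jacobiTheta₂ (1 / 2) (-1 / τ) =
      s * Complex.exp (π * Complex.I * τ / 4) * jacobiTheta₂ (τ / 2) τ := by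
    rw [jacobiTheta₂_functional_equation (τ / 2) τ, ← hs,
      show -π * Complex.I * (τ / 2) ^ 2 / τ = -(π * Complex.I * τ / 4) by field_simp; ring,
      Complex.exp_neg, show τ / 2 / τ = 1 / 2 by field_simp]
    field_simp
  have ha : jacobiTheta₂ (-1 / τ / 2) (-1 / τ) =
      s * Complex.exp (π * Complex.I / (4 * τ)) * jacobiTheta₂ (1 / 2) τ := by
    rw [jacobiTheta₂_functional_equation (1 / 2) τ, ← hs,
      show -π * Complex.I * (1 / 2) ^ 2 / τ = -(π * Complex.I / (4 * τ)) by field_simp; ring,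
      Complex.exp_neg, ← jacobiTheta₂_neg_left (1 / 2 / τ),
      show -(1 / 2 / τ) = -1 / τ / 2 by field_simp]
    field_simp
  have h24 : s ^ 24 = τ ^ 12 := by
    rw [show 24 = 2 * 12 by rfl, pow_mul, hs2, mul_pow, neg_pow, show 12 = 4 * 3 by rfl,
      pow_mul Complex.I, Complex.I_pow_four]
    norm_num
  have he1 : Complex.exp (π * Complex.I * τ / 4) ^ 8 = Complex.exp (2 * π * Complex.I * τ) := by
    rw [← Complex.exp_nat_mul]
    congr 1
    push_cast
    ring
  have he2 : Complex.exp (2 * π * Complex.I * (-1 / τ)) *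
      Complex.exp (π * Complex.I / (4 * τ)) ^ 8 = 1 := by
    rw [← Complex.exp_nat_mul, ← Complex.exp_add, Complex.exp_eq_one_iff]
    refine ⟨0, ?_⟩
    push_cast
    field_simp
    ring
  rw [thetaProduct, ha, hb, hc, thetaProduct]
  simp only [mul_pow, he1]
  rw [← h24]
  linear_combination s ^ 24 * jacobiTheta₂ (1 / 2) τ ^ 8 * jacobiTheta₂ 0 τ ^ 8 *
    Complex.exp (2 * π * Complex.I * τ) * jacobiTheta₂ (τ / 2) τ ^ 8 * he2

lemma norm_jacobiTheta₂_le {z₀ z τ : ℂ}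
    (h : ∀ n : ℤ, ‖jacobiTheta₂_term n z τ‖ ≤ ‖jacobiTheta₂_term n z₀ Complex.I‖) :
    ‖jacobiTheta₂ z τ‖ ≤ ∑' n : ℤ, ‖jacobiTheta₂_term n z₀ Complex.I‖ :=
  tsum_of_norm_bounded
    ((summable_jacobiTheta₂_term_iff z₀ Complex.I).2 (by simp)).norm.hasSum h

lemma exists_norm_thetaProduct_le :
    ∃ C : ℝ, ∀ τ : ℂ, 1 ≤ τ.im → ‖thetaProduct τ‖ ≤ rexp (-2 * π * τ.im) * C := by
  set A := ∑' n : ℤ, ‖jacobiTheta₂_term n (Complex.I / 2) Complex.I‖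
  set B := ∑' n : ℤ, ‖jacobiTheta₂_term n 0 Complex.I‖
  refine ⟨(A * B * B) ^ 8, fun τ hτ ↦ ?_⟩
  have key : ∀ z : ℂ, z.im = 0 → ‖jacobiTheta₂ z τ‖ ≤ B := fun z hz ↦ by
    refine norm_jacobiTheta₂_le fun n ↦ ?_
    simp only [norm_jacobiTheta₂_term, hz]
    apply exp_le_exp.2
    have : 0 ≤ π * (n : ℝ) ^ 2 := by positivity
    simp
    nlinarith
  have hA : ‖jacobiTheta₂ (τ / 2) τ‖ ≤ A := by
    refine norm_jacobiTheta₂_le fun n ↦ ?_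
    simp only [norm_jacobiTheta₂_term]
    apply exp_le_exp.2
    have h1 : (0 : ℝ) ≤ (n : ℝ) ^ 2 + n := by
      have : (0 : ℤ) ≤ n ^ 2 + n := by nlinarith [sq_nonneg (2 * n + 1)]
      exact_mod_cast this
    have : 0 ≤ π * ((n : ℝ) ^ 2 + n) := by positivity
    simp
    nlinarith
  have hA0 : 0 ≤ A := tsum_nonneg fun n ↦ norm_nonneg _
  have hB0 : 0 ≤ B := tsum_nonneg fun n ↦ norm_nonneg _
  rw [thetaProduct, norm_mul, norm_pow, norm_mul, norm_mul, Complex.norm_exp]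
  have he : (2 * π * Complex.I * τ).re = -2 * π * τ.im := by simp
  rw [he]
  gcongr
  · exact key 0 (by simp)
  · exact key (1 / 2) (by norm_num)

lemma differentiableAt_thetaProduct {τ : ℂ} (hτ : 0 < τ.im) :
    DifferentiableAt ℂ thetaProduct τ := by
  have ha : DifferentiableAt ℂ (fun τ : ℂ ↦ jacobiTheta₂ (τ / 2) τ) τ :=
    DifferentiableAt.comp (g := fun p : ℂ × ℂ ↦ jacobiTheta₂ p.1 p.2) τ
      (hasFDerivAt_jacobiTheta₂ (τ / 2) hτ).differentiableAt
      (f := fun τ : ℂ ↦ (τ / 2, τ)) (by fun_prop)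
  have hb := differentiableAt_jacobiTheta₂_snd 0 hτ
  have hc := differentiableAt_jacobiTheta₂_snd (1 / 2) hτ
  unfold thetaProduct
  fun_prop

lemma thetaProduct_isZeroAtImInfty : IsZeroAtImInfty fun z : ℍ ↦ thetaProduct z := by
  obtain ⟨C, hC⟩ := exists_norm_thetaProduct_le
  have hlim : Tendsto (fun z : ℍ ↦ rexp (-2 * π * z.im) * C) atImInfty (𝓝 0) := by
    rw [← zero_mul C]
    refine Tendsto.mul_const C (tendsto_exp_atBot.comp ?_)
    exact (tendsto_comap (f := UpperHalfPlane.im)).const_mul_atTop_of_neg (by linarith [pi_pos])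
  refine squeeze_zero_norm' ?_ hlim
  filter_upwards [tendsto_comap.eventually_ge_atTop 1] with z hz
  exact hC z hz

lemma thetaProduct_slash_T :
    ((fun z : ℍ ↦ thetaProduct z) ∣[(12 : ℤ)] ModularGroup.T) = fun z : ℍ ↦ thetaProduct z := by
  ext z
  rw [SL_slash_apply, ModularGroup.denom_apply, modular_T_smul, ModularGroup.coe_T]
  simp [add_comm (1 : ℂ), thetaProduct_add_one]

lemma thetaProduct_slash_S :
    ((fun z : ℍ ↦ thetaProduct z) ∣[(12 : ℤ)] ModularGroup.S) = fun z : ℍ ↦ thetaProduct z := by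
  ext z
  have h := thetaProduct_neg_inv (UpperHalfPlane.ne_zero z)
  rw [SL_slash_apply, ModularGroup.denom_S, UpperHalfPlane.modular_S_smul]
  rw [neg_div, one_div] at h
  have := UpperHalfPlane.ne_zero z
  simp [h]
  field_simp

/-- The eighth power of the product of the theta constants as a cusp form of weight 12. -/
noncomputable def thetaCuspForm : CuspForm 𝒮ℒ 12 where
  toFun z := thetaProduct z
  slash_action_eq' A hA := by
    obtain ⟨A, rfl⟩ := hA
    exact SlashInvariantForm.slash_action_generators_SL2Z thetaProduct_slash_S
      thetaProduct_slash_T A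
  holo' := by
    rw [UpperHalfPlane.mdifferentiable_iff]
    refine .congr (fun z hz ↦ (differentiableAt_thetaProduct hz).differentiableWithinAt)
      fun z hz ↦ ?_
    simp [ofComplex_apply_of_im_pos hz]
  zero_at_cusps' hc := by
    rw [Subgroup.IsArithmetic.isCusp_iff_isCusp_SL2Z] at hc
    rw [OnePoint.isZeroAt_iff_forall_SL2Z hc]
    intro γ _
    rw [SlashInvariantForm.slash_action_generators_SL2Z thetaProduct_slash_S thetaProduct_slash_T]
    exact thetaProduct_isZeroAtImInfty

lemma exists_thetaProduct_eq_eta : ∃ c : ℂ, ∀ z : ℍ, thetaProduct z = c * eta z ^ 24 := by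
  obtain ⟨c, hc⟩ := CuspForm.exists_smul_discriminant_of_weight_eq_twelve thetaCuspForm
  exact ⟨c, fun z ↦ (DFunLike.congr_fun hc z).symm⟩

end ThetaDiscriminant

section EisensteinSeries

open Set Filter Topology UpperHalfPlane ModularForm EisensteinSeries HurwitzZeta

variable {q x : ℝ}

lemma thetaProduct_I_mul (hx : 0 < x) :
    thetaProduct (Complex.I * x) =
      (((nomeTheta (rexp (-π * x)) ^ 4 - nomeTheta (-rexp (-π * x)) ^ 4) *
        nomeTheta (rexp (-π * x)) ^ 4 * nomeTheta (-rexp (-π * x)) ^ 4 : ℝ) : ℂ) ^ 2 := by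
  have h0 : (nomeTheta (rexp (-π * x)) : ℂ) = jacobiTheta₂ 0 (Complex.I * x) := by
    rw [nomeTheta_exp hx, evenKernel_eq_cosKernel_of_zero]
    simpa using cosKernel_def 0 x
  have h1 : (nomeTheta (-rexp (-π * x)) : ℂ) = jacobiTheta₂ (1 / 2) (Complex.I * x) := by
    rw [nomeTheta_neg_exp hx, cosKernel_def]
    simp
  have h2 := evenKernel_def (1 / 2) x
  rw [show ((1 / 2 : ℝ) : ℂ) * Complex.I * x = Complex.I * x / 2 by push_cast; ring] at h2
  have h3 : Complex.exp (2 * π * Complex.I * (Complex.I * x)) =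
      Complex.exp (-π * ((1 / 2 : ℝ) : ℂ) ^ 2 * x) ^ 8 := by
    rw [← Complex.exp_nat_mul]
    congr 1
    push_cast
    linear_combination 2 * π * x * Complex.I_sq
  rw [sub_eq_of_eq_add' (nomeTheta_pow_four hx), thetaProduct, h3, ← h0, ← h1, mul_pow, mul_pow,
    ← mul_assoc, ← mul_assoc, ← mul_pow, ← h2]
  push_cast
  ring

lemma hasDerivAt_eta_I_mul (hx : 0 < x) :
    HasDerivAt (fun y : ℝ ↦ eta (Complex.I * y))
      (-π / 12 * E2 ⟨Complex.I * x, by simpa⟩ * eta (Complex.I * x)) x := by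
  have him : 0 < (Complex.I * x).im := by simpa
  have h := logDeriv_eta_eq_E2 ⟨Complex.I * x, him⟩
  have hη : eta (Complex.I * x) ≠ 0 := eta_ne_zero him
  rw [logDeriv_apply, div_eq_iff hη] at h
  have hd := (differentiableAt_eta_of_mem_upperHalfPlaneSet him).hasDerivAt
  have := (HasDerivAt.comp (x : ℂ) hd ((hasDerivAt_id (x : ℂ)).const_mul Complex.I)).comp_ofReal
  refine this.congr_deriv ?_
  simp only [] at h
  rw [h]
  linear_combination π / 12 * E2 ⟨Complex.I * x, him⟩ * eta (Complex.I * x) * Complex.I_sq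

lemma E2_I_mul_mul (hx : 0 < x) {N : ℝ → ℝ} {N' : ℝ}
    (hN : ∀ y : ℝ, 0 < y → thetaProduct (Complex.I * y) = (N y : ℂ) ^ 2)
    (h0 : N x ≠ 0) (hN' : HasDerivAt N N' x) :
    (N' : ℂ) = -π * E2 ⟨Complex.I * x, by simpa⟩ * N x := by
  obtain ⟨c, hc⟩ := exists_thetaProduct_eq_eta
  have hcN (y : ℝ) (hy : 0 < y) : (N y : ℂ) ^ 2 = c * eta (Complex.I * y) ^ 24 := by
    rw [← hN y hy]
    exact hc ⟨Complex.I * y, by simpa⟩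
  have h1 := hN'.ofReal_comp.pow 2
  have h2 := ((hasDerivAt_eta_I_mul hx).pow 24).const_mul c
  have h3 := h1.unique (h2.congr_of_eventuallyEq (by
    filter_upwards [eventually_gt_nhds hx] with y hy
    simpa using hcN y hy))
  have h0' : (N x : ℂ) ≠ 0 := by exact_mod_cast h0
  apply mul_left_cancel₀ (mul_ne_zero two_ne_zero h0')
  push_cast at h3
  have := hcN x hx
  rw [pow_one] at h3
  linear_combination h3 + 2 * π * E2 ⟨Complex.I * x, by simpa⟩ * this

theorem E2_I_mul (hx : 0 < x) :
    E2 ⟨Complex.I * x, by simpa⟩ =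
      ((6 / π * nomeTheta (rexp (-π * x)) ^ 2 * ellipticE (nomeModulus (rexp (-π * x))) -
        nomeTheta (rexp (-π * x)) ^ 4 - nomeTheta (-rexp (-π * x)) ^ 4 : ℝ) : ℂ) := by
  have hq := exp_neg_pi_mul_mem_Ioo hx
  have habs := abs_lt_one_of_mem_Ioo hq
  have hF0 := nomeTheta_pos hq
  have hM0 := nomeTheta_neg_pos hq.1 hq.2
  have hFM := nomeTheta_neg_pow_four_lt hq
  have hexp : HasDerivAt (fun y : ℝ ↦ rexp (-π * y)) (rexp (-π * x) * (-π)) x := by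
    simpa using ((hasDerivAt_id x).const_mul (-π)).exp
  have hF := HasDerivAt.comp x (hasDerivAt_nomeTheta habs) hexp
  have hM := HasDerivAt.comp x (hasDerivAt_nomeTheta_neg habs) hexp
  have hN := (((hF.pow 4).sub (hM.pow 4)).mul (hF.pow 4)).mul (hM.pow 4)
  have hN0 : (nomeTheta (rexp (-π * x)) ^ 4 - nomeTheta (-rexp (-π * x)) ^ 4) *
      nomeTheta (rexp (-π * x)) ^ 4 * nomeTheta (-rexp (-π * x)) ^ 4 ≠ 0 := by
    have := sub_pos.2 hFM
    positivity
  have key := E2_I_mul_mul hx (fun y hy ↦ thetaProduct_I_mul hy) hN0 hN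
  have hlog := logDeriv_nomeTheta_add_neg hq
  rw [ellipticE_nomeModulus hq]
  have hN0' := Complex.ofReal_ne_zero.2 hN0
  apply mul_right_cancel₀ hN0'
  apply mul_left_cancel₀ (neg_ne_zero.2 (Complex.ofReal_ne_zero.2 pi_ne_zero))
  rw [← mul_assoc, ← key]
  norm_cast
  simp only [Function.comp_apply, Pi.pow_apply, Pi.sub_apply, Pi.mul_apply]
  generalize nomeTheta (rexp (-π * x)) = F at *
  generalize nomeTheta (-rexp (-π * x)) = M at *
  generalize deriv nomeTheta (rexp (-π * x)) = f at *
  generalize deriv nomeTheta (-rexp (-π * x)) = m at *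
  generalize rexp (-π * x) = r at *
  have hf : r * f = F * (r * f / F) := by field_simp
  have hm : r * m = M * (1 / 4 * (F ^ 4 - M ^ 4) - r * f / F) := by
    rw [← hlog]
    field_simp
    ring
  generalize r * f / F = p at *
  linear_combination
    -π * (4 * F ^ 7 + (F ^ 4 - M ^ 4) * 4 * F ^ 3) * M ^ 4 * hf -
      π * (4 * M ^ 7 * F ^ 4 - (F ^ 4 - M ^ 4) * F ^ 4 * 4 * M ^ 3) * hm

open ArithmeticFunction in
lemma tsum_one_div_sinh_sq (hx : 0 < x) :
    (∑' m : ℕ+, 1 / sinh (π * m * x) ^ 2 : ℝ) =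
      (1 - E2 ⟨Complex.I * x, by simpa⟩) / 6 := by
  set r := rexp (-(2 * π * x)) with hr
  have hr1 : r < 1 := exp_lt_one_iff.2 (neg_neg_of_pos (by positivity))
  have hr0 : 0 < r := exp_pos _
  have hterm (m : ℕ+) :
      1 / sinh (π * m * x) ^ 2 = 4 * ∑' c : ℕ+, (c : ℝ) ^ 1 * r ^ (m * c : ℕ) := by
    have hrm : r ^ (m : ℕ) < 1 := pow_lt_one₀ hr0.le hr1 m.ne_zero
    have hs := hasSum_coe_mul_geometric_of_norm_lt_one (𝕜 := ℝ) (r := r ^ (m : ℕ))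
      (by rwa [norm_of_nonneg (by positivity)])
    have hs' : ∑' c : ℕ+, (c : ℝ) ^ 1 * r ^ (m * c : ℕ) =
        r ^ (m : ℕ) / (1 - r ^ (m : ℕ)) ^ 2 := by
      rw [← hs.tsum_eq, ← tsum_zero_pnat_eq_tsum_nat hs.summable]
      simp [pow_mul]
    have he : r ^ (m : ℕ) = rexp (-(π * m * x)) ^ 2 := by
      rw [hr, ← exp_nat_mul, ← exp_nat_mul]
      congr 1
      push_cast
      ring
    have he0 := exp_pos (-(π * m * x))
    have hinv : rexp (π * m * x) = (rexp (-(π * m * x)))⁻¹ := by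
      rw [exp_neg, inv_inv]
    rw [he] at hrm
    rw [hs', he, sinh_eq, hinv]
    generalize rexp (-(π * m * x)) = s at *
    have : 1 - s ^ 2 ≠ 0 := by linarith
    rw [show (s⁻¹ - s) / 2 = (1 - s ^ 2) / (2 * s) by field_simp]
    field_simp
    norm_num
  have hq : Complex.exp (2 * π * Complex.I * (Complex.I * x)) = (r : ℂ) := by
    rw [hr, Complex.ofReal_exp]
    congr 1
    push_cast
    linear_combination 2 * π * x * Complex.I_sq
  rw [tsum_congr hterm, tsum_mul_left, tsum_prod_pow_eq_tsum_sigma 1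
    (by rwa [norm_of_nonneg hr0.le]), E2_eq_tsum_cexp]
  simp only [hq]
  push_cast
  ring

end EisensteinSeries

/-- The sum of inverse squared hyperbolic sines at `x = xRatio k`. -/
theorem csch_sq_sum_elliptic (k : ℝ) (hk : k ∈ Set.Ioo (0:ℝ) 1) :
    ∑' m : ℕ+, 1 / Real.sinh (π * m * xRatio k) ^ 2 =
      1 / 6 + (2 * (2 - k ^ 2) / (3 * π ^ 2)) * ellipticK k ^ 2 -
        (2 / π ^ 2) * ellipticK k * ellipticE k := by
  have hx := xRatio_pos hk
  have hq := exp_neg_pi_mul_mem_Ioo hx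
  have hm := nomeModulus_exp_xRatio hk
  have hF := nomeTheta_pos hq
  have hK := ellipticK_nomeModulus hq
  have hM := nomeModulus_sq hq
  have hS := tsum_one_div_sinh_sq hx
  rw [E2_I_mul hx, hm] at hS
  rw [hm] at hK hM
  norm_cast at hS
  rw [hS, hK, hM]
  generalize nomeTheta (rexp (-π * xRatio k)) = F at *
  generalize nomeTheta (-rexp (-π * xRatio k)) = M at *
  field_simp
  ring
end

section
/- For k ∈ (0,1) let x = K(k′)/K(k) where k′ = √(1−k²). Then ∑_{m=1}^∞ 1/cosh²(πx(m−1/2)) = (2/π²)K(k)E(k) − (2(1−k²)/π²)K(k)². -/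
open Real

section ThetaSeries

open Filter Topology

/-- The series `∑ c n exp (-π n² t)` over the integers. -/
noncomputable def thetaSeries (c : ℤ → ℝ) (t : ℝ) : ℝ :=
  ∑' n : ℤ, c n * rexp (-π * (n : ℝ) ^ 2 * t)

lemma summable_abs_pow_mul_exp (k : ℕ) {t : ℝ} (ht : 0 < t) :
    Summable fun n : ℤ => |(n : ℝ)| ^ k * rexp (-π * (n : ℝ) ^ 2 * t) := by
  refine (summable_pow_mul_jacobiTheta₂_term_bound 0 ht k).congr fun n => ?_
  push_cast
  congr 2
  ring

lemma summable_thetaSeries {c : ℤ → ℝ} {K : ℝ} {k : ℕ} (hc : ∀ n, |c n| ≤ K * |(n : ℝ)| ^ k)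
    {t : ℝ} (ht : 0 < t) : Summable fun n : ℤ => c n * rexp (-π * (n : ℝ) ^ 2 * t) := by
  refine Summable.of_norm_bounded ((summable_abs_pow_mul_exp k ht).mul_left K) fun n => ?_
  rw [norm_mul, norm_eq_abs, norm_eq_abs, abs_exp, ← mul_assoc]
  gcongr
  exact hc n

lemma hasDerivAt_thetaSeries {c : ℤ → ℝ} {K : ℝ} {k : ℕ} (hc : ∀ n, |c n| ≤ K * |(n : ℝ)| ^ k)
    {t : ℝ} (ht : 0 < t) :
    HasDerivAt (thetaSeries c) (-π * thetaSeries (fun n => (n : ℝ) ^ 2 * c n) t) t := by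
  have hderiv : HasDerivAt (thetaSeries c)
      (∑' n : ℤ, -π * ((n : ℝ) ^ 2 * c n * rexp (-π * (n : ℝ) ^ 2 * t))) t := by
    refine hasDerivAt_tsum_of_isPreconnected (t := Set.Ioi (t / 2))
      (u := fun n : ℤ => π * (K * (|(n : ℝ)| ^ (k + 2) * rexp (-π * (n : ℝ) ^ 2 * (t / 2)))))
      (((summable_abs_pow_mul_exp (k + 2) (half_pos ht)).mul_left K).mul_left π) isOpen_Ioi
      isPreconnected_Ioi (g := fun n t => c n * rexp (-π * (n : ℝ) ^ 2 * t))
      (g' := fun n t => -π * ((n : ℝ) ^ 2 * c n * rexp (-π * (n : ℝ) ^ 2 * t)))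
      (y₀ := t) ?_ ?_ (by simpa using ht) (summable_thetaSeries hc ht) (by simpa using ht)
    · intro n y _
      have h := (((hasDerivAt_id y).const_mul (-π * (n : ℝ) ^ 2)).exp).const_mul (c n)
      refine h.congr_deriv ?_
      simp only [id]
      ring
    · intro n y hy
      have hy' : t / 2 < y := hy
      rw [norm_mul, norm_mul, norm_mul, norm_eq_abs, norm_eq_abs, norm_eq_abs, norm_eq_abs,
        abs_exp, abs_neg, abs_of_pos pi_pos]
      have h1 : |(n : ℝ) ^ 2| * |c n| ≤ K * |(n : ℝ)| ^ (k + 2) := by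
        rw [abs_pow]
        calc |(n : ℝ)| ^ 2 * |c n| ≤ |(n : ℝ)| ^ 2 * (K * |(n : ℝ)| ^ k) := by
              gcongr; exact hc n
          _ = _ := by ring
      have h2 : rexp (-π * (n : ℝ) ^ 2 * y) ≤ rexp (-π * (n : ℝ) ^ 2 * (t / 2)) := by
        apply exp_le_exp.2
        have : 0 ≤ π * (n : ℝ) ^ 2 := by positivity
        nlinarith
      have := mul_le_mul h1 h2 (exp_pos _).le ((by positivity : (0 : ℝ) ≤ _).trans h1)
      rw [← mul_assoc K]
      gcongr
  refine hderiv.congr_deriv ?_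
  rw [tsum_mul_left, thetaSeries]

lemma tendsto_exp_mul_thetaSeries {c : ℤ → ℝ} {K : ℝ} {k : ℕ}
    (hc : ∀ n, |c n| ≤ K * |(n : ℝ)| ^ k) (h0 : c 0 = 0) :
    Tendsto (fun t => rexp (π * t) * thetaSeries c t) atTop (𝓝 (c 1 + c (-1))) := by
  have hlim : ∑' n : ℤ, (if n ∈ ({1, -1} : Finset ℤ) then c n else 0) = c 1 + c (-1) := by
    rw [tsum_eq_sum (s := {1, -1}) (fun n hn => if_neg hn)]
    simp
  rw [← hlim]
  simp_rw [thetaSeries, ← tsum_mul_left]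
  refine tendsto_tsum_of_dominated_convergence
    (bound := fun n => rexp π * (K * (|(n : ℝ)| ^ k * rexp (-π * (n : ℝ) ^ 2 * 1))))
    (((summable_abs_pow_mul_exp k one_pos).mul_left K).mul_left _) (fun n => ?_) ?_
  · have hform : (fun t => rexp (π * t) * (c n * rexp (-π * (n : ℝ) ^ 2 * t))) =
        fun t => c n * rexp (-(π * ((n : ℝ) ^ 2 - 1) * t)) := by
      ext t
      rw [mul_left_comm, ← Real.exp_add]
      ring_nf
    rw [hform]
    split_ifs with hn
    · have hn1 : (n : ℝ) ^ 2 = 1 := by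
        simp only [Finset.mem_insert, Finset.mem_singleton] at hn
        rcases hn with rfl | rfl <;> norm_num
      simp [hn1]
    · rcases eq_or_ne n 0 with rfl | hn0
      · simp [h0]
      · have hn2 : (1 : ℤ) < n ^ 2 := by
          simp only [Finset.mem_insert, Finset.mem_singleton, not_or] at hn
          have : (1 : ℤ) < |n| := by
            rcases abs_cases n with h | h <;> omega
          rw [← sq_abs]
          nlinarith
        have hn3 : (1 : ℝ) < (n : ℝ) ^ 2 := by exact_mod_cast hn2
        have h := (tendsto_exp_neg_atTop_nhds_zero.comp
          (tendsto_id.const_mul_atTop (mul_pos pi_pos (sub_pos.2 hn3)))).const_mul (c n)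
        simpa [Function.comp_def] using h
  · filter_upwards [eventually_ge_atTop 1] with t ht n
    rw [norm_mul, norm_mul, norm_eq_abs, norm_eq_abs, norm_eq_abs, abs_exp, abs_exp]
    rcases eq_or_ne n 0 with rfl | hn0
    · rw [h0, abs_zero, zero_mul, mul_zero]
      have := (abs_nonneg _).trans (hc 0)
      have h := mul_nonneg this (exp_pos (-π * ((0 : ℤ) : ℝ) ^ 2 * 1)).le
      rw [mul_assoc] at h
      exact mul_nonneg (exp_pos _).le h
    · have hn1 : (1 : ℝ) ≤ (n : ℝ) ^ 2 := by
        have : 0 < n ^ 2 := by positivity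
        exact_mod_cast this
      have hexp : rexp (π * t) * rexp (-π * (n : ℝ) ^ 2 * t) ≤
          rexp π * rexp (-π * (n : ℝ) ^ 2 * 1) := by
        rw [← Real.exp_add, ← Real.exp_add]
        apply exp_le_exp.2
        have := mul_nonneg pi_pos.le (mul_nonneg (sub_nonneg.2 hn1) (sub_nonneg.2 ht))
        nlinarith
      calc rexp (π * t) * (|c n| * rexp (-π * (n : ℝ) ^ 2 * t))
          = |c n| * (rexp (π * t) * rexp (-π * (n : ℝ) ^ 2 * t)) := by ring
        _ ≤ (K * |(n : ℝ)| ^ k) * (rexp π * rexp (-π * (n : ℝ) ^ 2 * 1)) :=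
            mul_le_mul (hc n) hexp (by positivity) ((abs_nonneg _).trans (hc n))
        _ = _ := by ring

lemma tendsto_thetaSeries {c : ℤ → ℝ} {K : ℝ} {k : ℕ} (hc : ∀ n, |c n| ≤ K * |(n : ℝ)| ^ k) :
    Tendsto (thetaSeries c) atTop (𝓝 (c 0)) := by
  have hlim : ∑' n : ℤ, (if n = 0 then c 0 else 0) = c 0 := tsum_ite_eq 0 _
  rw [← hlim]
  refine tendsto_tsum_of_dominated_convergence
    (bound := fun n => K * (|(n : ℝ)| ^ k * rexp (-π * (n : ℝ) ^ 2 * 1)))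
    ((summable_abs_pow_mul_exp k one_pos).mul_left K) (fun n => ?_) ?_
  · split_ifs with hn
    · simp [hn]
    · have hn3 : (0 : ℝ) < (n : ℝ) ^ 2 := by positivity
      have h := (tendsto_exp_neg_atTop_nhds_zero.comp
          (tendsto_id.const_mul_atTop (mul_pos pi_pos hn3))).const_mul (c n)
      simpa [Function.comp_def] using h
  · filter_upwards [eventually_ge_atTop 1] with t ht n
    rw [norm_mul, norm_eq_abs, norm_eq_abs, abs_exp, ← mul_assoc]
    refine mul_le_mul (hc n) (exp_le_exp.2 ?_) (exp_pos _).le ((abs_nonneg _).trans (hc n))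
    have : 0 ≤ π * (n : ℝ) ^ 2 := by positivity
    nlinarith

end ThetaSeries

section ThetaIdentities

open Filter Topology

/-- The theta constant `θ₃` at the nome `exp (-π t)`. -/
noncomputable def thetaThree (t : ℝ) : ℝ := thetaSeries (fun _ => 1) t

/-- The theta constant `θ₄` at the nome `exp (-π t)`. -/
noncomputable def thetaFour (t : ℝ) : ℝ := thetaSeries (fun n => (-1) ^ n) t

lemma abs_one_le_mul_pow (n : ℤ) : |(1 : ℝ)| ≤ 1 * |(n : ℝ)| ^ 0 := by simp

lemma abs_neg_one_zpow_le_mul_pow (n : ℤ) : |(-1 : ℝ) ^ n| ≤ 1 * |(n : ℝ)| ^ 0 := by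
  simp [abs_zpow]

lemma tsum_prod_eq_tsum_add_sub {F : ℤ × ℤ → ℝ} (hF : ∀ a b, Odd (a + b) → F (a, b) = 0) :
    ∑' z, F z = ∑' z : ℤ × ℤ, F (z.1 + z.2, z.1 - z.2) := by
  have hinj : Function.Injective fun z : ℤ × ℤ => (z.1 + z.2, z.1 - z.2) := by
    rintro ⟨a, b⟩ ⟨c, d⟩ h
    simp only [Prod.mk.injEq] at h ⊢
    omega
  refine (hinj.tsum_eq fun z hz => ?_).symm
  have : Even (z.1 + z.2) := by
    by_contra h
    exact hz (hF _ _ (Int.not_even_iff_odd.1 h))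
  obtain ⟨r, hr⟩ := this
  refine ⟨(r, z.1 - r), ?_⟩
  ext <;> dsimp <;> omega

lemma thetaSeries_mul {c d : ℤ → ℝ} (hc : ∀ n, |c n| ≤ 1 * |(n : ℝ)| ^ 0)
    (hd : ∀ n, |d n| ≤ 1 * |(n : ℝ)| ^ 0) {t : ℝ} (ht : 0 < t) :
    HasSum (fun z : ℤ × ℤ => c z.1 * d z.2 * rexp (-π * ((z.1 : ℝ) ^ 2 + (z.2 : ℝ) ^ 2) * t))
      (thetaSeries c t * thetaSeries d t) := by
  have h1 := (summable_thetaSeries hc ht).norm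
  have h2 := (summable_thetaSeries hd ht).norm
  have h := (summable_mul_of_summable_norm h1 h2).hasSum
  rw [← tsum_mul_tsum_of_summable_norm h1 h2] at h
  refine h.congr_fun fun z => ?_
  rw [mul_mul_mul_comm, ← Real.exp_add]
  ring_nf

lemma thetaThree_sq_add_thetaFour_sq {t : ℝ} (ht : 0 < t) :
    thetaThree t ^ 2 + thetaFour t ^ 2 = 2 * thetaThree (2 * t) ^ 2 := by
  have h := (thetaSeries_mul abs_one_le_mul_pow abs_one_le_mul_pow ht).add
    (thetaSeries_mul abs_neg_one_zpow_le_mul_pow abs_neg_one_zpow_le_mul_pow ht)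
  have h' := (thetaSeries_mul abs_one_le_mul_pow abs_one_le_mul_pow
    (mul_pos two_pos ht)).mul_left 2
  rw [thetaThree, thetaFour, thetaThree, sq, sq, sq, ← h.tsum_eq, ← h'.tsum_eq,
    tsum_prod_eq_tsum_add_sub]
  · refine tsum_congr fun z => ?_
    have : (-1 : ℝ) ^ (z.1 + z.2) * (-1) ^ (z.1 - z.2) = 1 := by
      rw [← zpow_add₀ (by norm_num)]
      exact Even.neg_one_zpow ⟨z.1, by ring⟩
    rw [this]
    push_cast
    ring_nf
  · intro a b hab
    rw [← zpow_add₀ (by norm_num), hab.neg_one_zpow]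
    ring

lemma thetaThree_mul_thetaFour {t : ℝ} (ht : 0 < t) :
    thetaThree t * thetaFour t = thetaFour (2 * t) ^ 2 := by
  have h := ((thetaSeries_mul abs_one_le_mul_pow abs_neg_one_zpow_le_mul_pow ht).add
    (thetaSeries_mul abs_neg_one_zpow_le_mul_pow abs_one_le_mul_pow ht)).mul_left (1 / 2)
  have h' := thetaSeries_mul abs_neg_one_zpow_le_mul_pow abs_neg_one_zpow_le_mul_pow
    (mul_pos two_pos ht)
  have hs : thetaThree t * thetaFour t = 1 / 2 * (thetaThree t * thetaFour t +
    thetaFour t * thetaThree t) := by ring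
  rw [hs, sq, thetaThree, thetaFour, thetaFour, ← h.tsum_eq, ← h'.tsum_eq,
    tsum_prod_eq_tsum_add_sub]
  · refine tsum_congr fun z => ?_
    have h1 : (-1 : ℝ) ^ (z.1 + z.2) = (-1) ^ z.1 * (-1) ^ z.2 := zpow_add₀ (by norm_num) _ _
    have h2 : (-1 : ℝ) ^ (z.1 - z.2) = (-1) ^ z.1 * (-1) ^ z.2 := by
      rw [← h1, show z.1 + z.2 = (z.1 - z.2) + 2 * z.2 by ring, zpow_add₀ (by norm_num),
        Even.neg_one_zpow (even_two_mul z.2), mul_one]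
    dsimp only
    rw [h1, h2]
    push_cast
    ring_nf
  · intro a b hab
    have : (-1 : ℝ) ^ a + (-1) ^ b = 0 := by
      rcases Int.even_or_odd a with ha | ha
      · rw [ha.neg_one_zpow, Odd.neg_one_zpow (by grind)]
        ring
      · rw [ha.neg_one_zpow, Even.neg_one_zpow (by grind)]
        ring
    linear_combination 1 / 2 * rexp (-π * ((a : ℝ) ^ 2 + (b : ℝ) ^ 2) * t) * this

lemma thetaThree_pos {t : ℝ} (ht : 0 < t) : 0 < thetaThree t :=
  (summable_thetaSeries abs_one_le_mul_pow ht).tsum_pos (fun n => by positivity) 0 (by positivity)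

lemma thetaThree_one_div_sq {t : ℝ} (ht : 0 < t) :
    thetaThree (1 / t) ^ 2 = t * thetaThree t ^ 2 := by
  have h := Real.tsum_exp_neg_mul_int_sq ht
  have h1 : thetaThree t = ∑' n : ℤ, rexp (-π * t * (n : ℝ) ^ 2) :=
    tsum_congr fun n => by rw [one_mul]; ring_nf
  have h2 : thetaThree (1 / t) = ∑' n : ℤ, rexp (-π / t * (n : ℝ) ^ 2) :=
    tsum_congr fun n => by rw [one_mul]; ring_nf
  rw [← h1, ← h2, ← Real.sqrt_eq_rpow] at h
  rw [h, mul_pow, div_pow, Real.sq_sqrt ht.le]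
  field_simp

lemma tendsto_thetaThree : Tendsto thetaThree atTop (𝓝 1) :=
  tendsto_thetaSeries abs_one_le_mul_pow

lemma tendsto_thetaFour : Tendsto thetaFour atTop (𝓝 1) := by
  rw [← zpow_zero (-1 : ℝ)]
  exact tendsto_thetaSeries abs_neg_one_zpow_le_mul_pow

lemma tendsto_two_pow_mul {t : ℝ} (ht : 0 < t) :
    Tendsto (fun n : ℕ => 2 ^ n * t) atTop atTop :=
  (tendsto_pow_atTop_atTop_of_one_lt one_lt_two).atTop_mul_const ht

lemma thetaFour_ne_zero {t : ℝ} (ht : 0 < t) : thetaFour t ≠ 0 := by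
  intro h
  have hz : ∀ n : ℕ, thetaFour (2 ^ n * t) = 0 := by
    intro n
    induction n with
    | zero => simpa using h
    | succ n ih =>
      have := thetaThree_mul_thetaFour (t := 2 ^ n * t) (by positivity)
      rw [ih, mul_zero] at this
      rw [pow_succ', mul_assoc]
      exact pow_eq_zero_iff two_ne_zero |>.1 this.symm
  have hlim := tendsto_thetaFour.comp (tendsto_two_pow_mul ht)
  rw [show thetaFour ∘ (fun n : ℕ => 2 ^ n * t) = fun _ => 0 from funext hz] at hlim
  exact zero_ne_one (tendsto_nhds_unique tendsto_const_nhds hlim)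

/-- Squared Jacobi identity, with `θ₂ t` expressed as a multiple of `θ₄ (1 / t)`. -/
lemma thetaThree_pow_four {t : ℝ} (ht : 0 < t) :
    (thetaThree t ^ 2) ^ 2 = (thetaFour t ^ 2) ^ 2 + (thetaFour (1 / t) ^ 2 / t) ^ 2 := by
  have ht2 : 0 < 1 / (2 * t) := by positivity
  have hs : 2 * (1 / (2 * t)) = 1 / t := by field_simp
  have e1 := thetaThree_sq_add_thetaFour_sq ht2
  have e2 := thetaThree_mul_thetaFour ht2
  have e3 := thetaThree_sq_add_thetaFour_sq ht
  have f1 := thetaThree_one_div_sq ht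
  have f2 := thetaThree_one_div_sq (mul_pos two_pos ht)
  rw [hs] at e1 e2
  have e2' : thetaThree (1 / (2 * t)) ^ 2 * thetaFour (1 / (2 * t)) ^ 2 =
    (thetaFour (1 / t) ^ 2) ^ 2 := by rw [← e2]; ring
  rw [f1] at e1
  rw [f2] at e1 e2'
  rw [div_pow, ← e2']
  have hB : thetaFour (1 / (2 * t)) ^ 2 = 2 * t * thetaThree t ^ 2 -
      2 * t * thetaThree (2 * t) ^ 2 := by linear_combination e1
  rw [hB]
  field_simp
  linear_combination (thetaThree t ^ 2 - 2 * thetaThree (2 * t) ^ 2 - thetaFour t ^ 2) * e3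

lemma thetaFour_sq_lt_thetaThree_sq {t : ℝ} (ht : 0 < t) :
    thetaFour t ^ 2 < thetaThree t ^ 2 := by
  have h := thetaThree_pow_four ht
  have : 0 < (thetaFour (1 / t) ^ 2 / t) ^ 2 := by
    have := thetaFour_ne_zero (one_div_pos.2 ht)
    positivity
  exact lt_of_pow_lt_pow_left₀ 2 (sq_nonneg _) (by linarith)

end ThetaIdentities

section ThetaRatio

open Filter Topology

/-- The complementary modulus `θ₄² / θ₃²` at the nome `exp (-π t)`. -/
noncomputable def thetaRatio (t : ℝ) : ℝ := thetaFour t ^ 2 / thetaThree t ^ 2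

lemma thetaRatio_pos {t : ℝ} (ht : 0 < t) : 0 < thetaRatio t := by
  have := thetaFour_ne_zero ht
  have := thetaThree_pos ht
  unfold thetaRatio
  positivity

lemma thetaRatio_lt_one {t : ℝ} (ht : 0 < t) : thetaRatio t < 1 := by
  have := thetaThree_pos ht
  rw [thetaRatio, div_lt_one (by positivity)]
  exact thetaFour_sq_lt_thetaThree_sq ht

lemma thetaRatio_sq_add_sq {t : ℝ} (ht : 0 < t) :
    thetaRatio t ^ 2 + thetaRatio (1 / t) ^ 2 = 1 := by
  have h := thetaThree_pow_four ht
  have h3 := thetaThree_pos ht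
  rw [thetaRatio, thetaRatio, thetaThree_one_div_sq ht]
  field_simp
  field_simp at h
  linear_combination -h

/-- The derivative of `θ₃`. -/
noncomputable def thetaThreeDeriv (t : ℝ) : ℝ :=
  -π * thetaSeries (fun n => (n : ℝ) ^ 2 * 1) t

/-- The derivative of `θ₄`. -/
noncomputable def thetaFourDeriv (t : ℝ) : ℝ :=
  -π * thetaSeries (fun n => (n : ℝ) ^ 2 * (-1) ^ n) t

lemma hasDerivAt_thetaThree {t : ℝ} (ht : 0 < t) :
    HasDerivAt thetaThree (thetaThreeDeriv t) t :=
  hasDerivAt_thetaSeries abs_one_le_mul_pow ht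

lemma hasDerivAt_thetaFour {t : ℝ} (ht : 0 < t) :
    HasDerivAt thetaFour (thetaFourDeriv t) t :=
  hasDerivAt_thetaSeries abs_neg_one_zpow_le_mul_pow ht

lemma tendsto_exp_mul_thetaThreeDeriv :
    Tendsto (fun t => rexp (π * t) * thetaThreeDeriv t) atTop (𝓝 (-(2 * π))) := by
  have h := (tendsto_exp_mul_thetaSeries (c := fun n => (n : ℝ) ^ 2 * 1) (K := 1) (k := 2)
    (fun n => by simp) (by simp)).const_mul (-π)
  refine (h.congr fun t => ?_).trans (by norm_num; ring_nf)
  rw [thetaThreeDeriv]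
  ring

lemma tendsto_exp_mul_thetaFourDeriv :
    Tendsto (fun t => rexp (π * t) * thetaFourDeriv t) atTop (𝓝 (2 * π)) := by
  have h := (tendsto_exp_mul_thetaSeries (c := fun n => (n : ℝ) ^ 2 * (-1) ^ n) (K := 1) (k := 2)
    (fun n => by simp [abs_mul, abs_zpow]) (by simp)).const_mul (-π)
  refine (h.congr fun t => ?_).trans (by norm_num; ring_nf)
  rw [thetaFourDeriv]
  ring

lemma tendsto_exp_mul_thetaThree_sub_thetaFour :
    Tendsto (fun t => rexp (π * t) * (thetaThree t - thetaFour t)) atTop (𝓝 4) := by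
  have h := tendsto_exp_mul_thetaSeries (c := fun n => 1 - (-1) ^ n) (K := 2) (k := 0)
    (fun n => by
      refine (abs_sub _ _).trans ?_
      simp [abs_zpow]
      norm_num) (by simp)
  refine (h.congr' ?_).trans (by norm_num)
  filter_upwards [eventually_gt_atTop 0] with t ht
  congr 1
  rw [thetaThree, thetaFour, thetaSeries, thetaSeries, thetaSeries,
    ← (summable_thetaSeries abs_one_le_mul_pow ht).tsum_sub
      (summable_thetaSeries abs_neg_one_zpow_le_mul_pow ht)]
  exact tsum_congr fun n => by ring

/-- The logarithmic derivative of `thetaRatio`. -/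
noncomputable def thetaRatioLogDeriv (t : ℝ) : ℝ :=
  2 * (thetaFourDeriv t / thetaFour t - thetaThreeDeriv t / thetaThree t)

lemma hasDerivAt_thetaRatio {t : ℝ} (ht : 0 < t) :
    HasDerivAt thetaRatio (thetaRatio t * thetaRatioLogDeriv t) t := by
  have h3 := thetaThree_pos ht
  have h4 := thetaFour_ne_zero ht
  refine (((hasDerivAt_thetaFour ht).pow 2).div ((hasDerivAt_thetaThree ht).pow 2)
    (pow_ne_zero 2 h3.ne')).congr_deriv ?_
  simp only [Pi.pow_apply]
  rw [thetaRatio, thetaRatioLogDeriv]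
  push_cast
  field_simp

lemma thetaRatioLogDeriv_two_mul {t : ℝ} (ht : 0 < t) :
    thetaRatioLogDeriv (2 * t) * ((thetaThree t ^ 2) ^ 2 - (thetaFour t ^ 2) ^ 2) =
      thetaRatioLogDeriv t * ((thetaThree (2 * t) ^ 2) ^ 2 - (thetaFour (2 * t) ^ 2) ^ 2) := by
  have ht2 : 0 < 2 * t := by positivity
  have h3 := thetaThree_pos ht
  have h4 := thetaFour_ne_zero ht
  have k3 := thetaThree_pos ht2
  have k4 := thetaFour_ne_zero ht2
  have e1 := thetaThree_sq_add_thetaFour_sq ht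
  have e2 := thetaThree_mul_thetaFour ht
  have hlin : HasDerivAt (fun s : ℝ => 2 * s) 2 t := by
    simpa using (hasDerivAt_id t).const_mul (2 : ℝ)
  have d1 : 2 * thetaThree t * thetaThreeDeriv t + 2 * thetaFour t * thetaFourDeriv t =
      2 * (2 * thetaThree (2 * t) * (thetaThreeDeriv (2 * t) * 2)) := by
    have l := ((hasDerivAt_thetaThree ht).pow 2).add ((hasDerivAt_thetaFour ht).pow 2)
    have r := (((hasDerivAt_thetaThree ht2).comp t hlin).pow 2).const_mul 2
    have heq : (fun s => 2 * ((thetaThree ∘ fun s => 2 * s) ^ 2) s) =ᶠ[𝓝 t]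
        thetaThree ^ 2 + thetaFour ^ 2 := by
      filter_upwards [eventually_gt_nhds ht] with s hs
      simpa using (thetaThree_sq_add_thetaFour_sq hs).symm
    simpa using l.unique (r.congr_of_eventuallyEq heq.symm)
  have d2 : thetaThreeDeriv t * thetaFour t + thetaThree t * thetaFourDeriv t =
      2 * thetaFour (2 * t) * (thetaFourDeriv (2 * t) * 2) := by
    have l := (hasDerivAt_thetaThree ht).mul (hasDerivAt_thetaFour ht)
    have r := ((hasDerivAt_thetaFour ht2).comp t hlin).pow 2
    have heq : (thetaThree * thetaFour) =ᶠ[𝓝 t] (thetaFour ∘ fun s => 2 * s) ^ 2 := by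
      filter_upwards [eventually_gt_nhds ht] with s hs
      simpa using thetaThree_mul_thetaFour hs
    simpa using l.unique (r.congr_of_eventuallyEq heq)
  have q4 : thetaFourDeriv (2 * t) / thetaFour (2 * t) =
      (thetaThreeDeriv t / thetaThree t + thetaFourDeriv t / thetaFour t) / 4 := by
    have : thetaFourDeriv (2 * t) / thetaFour (2 * t) =
      (2 * thetaFour (2 * t) * (thetaFourDeriv (2 * t) * 2)) / (4 * thetaFour (2 * t) ^ 2) := by
      field_simp
      ring
    rw [this, ← d2, ← e2]
    field_simp
  have q3 : thetaThreeDeriv (2 * t) / thetaThree (2 * t) =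
      (thetaThree t * thetaThreeDeriv t + thetaFour t * thetaFourDeriv t) /
        (2 * (thetaThree t ^ 2 + thetaFour t ^ 2)) := by
    have : thetaThreeDeriv (2 * t) / thetaThree (2 * t) =
      (2 * (2 * thetaThree (2 * t) * (thetaThreeDeriv (2 * t) * 2))) /
        (4 * (2 * thetaThree (2 * t) ^ 2)) := by
      field_simp
      ring
    rw [this, ← d1, ← e1]
    field_simp
    ring
  have e1' : thetaThree (2 * t) ^ 2 = (thetaThree t ^ 2 + thetaFour t ^ 2) / 2 := by
    linear_combination -e1 / 2
  rw [thetaRatioLogDeriv, thetaRatioLogDeriv, q4, q3, e1', ← e2]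
  field_simp
  ring

/-- Both sides are modular of weight two, so their quotient is invariant under `t ↦ 2 t`, and the
limit at infinity identifies it. -/
lemma thetaRatioLogDeriv_eq {t : ℝ} (ht : 0 < t) :
    thetaRatioLogDeriv t = π / 2 * ((thetaThree t ^ 2) ^ 2 - (thetaFour t ^ 2) ^ 2) := by
  set D : ℝ → ℝ := fun t => (thetaThree t ^ 2) ^ 2 - (thetaFour t ^ 2) ^ 2 with hD
  have hDpos : ∀ {t : ℝ}, 0 < t → 0 < D t := fun {t} ht =>
    sub_pos.2 (pow_lt_pow_left₀ (thetaFour_sq_lt_thetaThree_sq ht) (sq_nonneg _) two_ne_zero)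
  have hinv : ∀ n : ℕ, thetaRatioLogDeriv (2 ^ n * t) / D (2 ^ n * t) =
      thetaRatioLogDeriv t / D t := by
    intro n
    induction n with
    | zero => simp
    | succ n ih =>
      have hn : 0 < 2 ^ n * t := by positivity
      rw [← ih, pow_succ', mul_assoc, div_eq_div_iff (hDpos (by positivity)).ne' (hDpos hn).ne']
      exact thetaRatioLogDeriv_two_mul hn
  have hnum : Tendsto (fun t => rexp (π * t) * thetaRatioLogDeriv t) atTop (𝓝 (8 * π)) := by
    have h := ((tendsto_exp_mul_thetaFourDeriv.div tendsto_thetaFour one_ne_zero).sub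
      (tendsto_exp_mul_thetaThreeDeriv.div tendsto_thetaThree one_ne_zero)).const_mul 2
    refine (h.congr fun t => ?_).trans (by ring_nf; rfl)
    rw [thetaRatioLogDeriv]
    simp only [Pi.div_apply]
    ring
  have hden : Tendsto (fun t => rexp (π * t) * D t) atTop (𝓝 16) := by
    have h := (tendsto_exp_mul_thetaThree_sub_thetaFour.mul
      (tendsto_thetaThree.add tendsto_thetaFour)).mul
      ((tendsto_thetaThree.pow 2).add (tendsto_thetaFour.pow 2))
    refine (h.congr fun t => ?_).trans (by norm_num)
    simp only [hD]
    ring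
  have hlim : Tendsto (fun t => thetaRatioLogDeriv t / D t) atTop (𝓝 (π / 2)) := by
    refine ((hnum.div hden (by norm_num)).congr fun t => ?_).trans (by ring_nf; rfl)
    simp only [Pi.div_apply]
    exact mul_div_mul_left _ _ (exp_ne_zero _)
  have h := hlim.comp (tendsto_two_pow_mul ht)
  rw [show (fun t => thetaRatioLogDeriv t / D t) ∘ (fun n : ℕ => 2 ^ n * t) =
    fun _ => thetaRatioLogDeriv t / D t from funext hinv] at h
  have := tendsto_nhds_unique tendsto_const_nhds h
  rwa [div_eq_iff (hDpos ht).ne'] at this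

lemma exists_thetaRatio_eq {r : ℝ} (hr : r ∈ Set.Ioo (0 : ℝ) 1) :
    ∃ t, 0 < t ∧ thetaRatio t = r := by
  have hlim : Tendsto thetaRatio atTop (𝓝 1) := by
    have h := (tendsto_thetaFour.pow 2).div (tendsto_thetaThree.pow 2) (by norm_num)
    rw [one_pow, div_one] at h
    exact h
  have hlim2 : Tendsto (fun t => thetaRatio t ^ 2) atTop (𝓝 1) := by simpa using hlim.pow 2
  have hr2 : 1 - r ^ 2 < 1 := by have := pow_pos hr.1 2; linarith
  obtain ⟨T, hT1, hT2, hT3⟩ := ((hlim.eventually_const_lt hr.2).and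
    ((hlim2.eventually_const_lt hr2).and (eventually_ge_atTop 1))).exists
  have hT0 : 0 < T := by linarith
  have hsmall : thetaRatio (1 / T) < r := by
    have := thetaRatio_sq_add_sq hT0
    exact lt_of_pow_lt_pow_left₀ 2 hr.1.le (by linarith)
  have hle : 1 / T ≤ T := by
    rw [div_le_iff₀ hT0]
    nlinarith
  have hcont : ContinuousOn thetaRatio (Set.Icc (1 / T) T) := fun x hx =>
    (hasDerivAt_thetaRatio ((one_div_pos.2 hT0).trans_le hx.1)).continuousAt.continuousWithinAt
  obtain ⟨t, ht, htr⟩ := intermediate_value_Icc hle hcont ⟨hsmall.le, hT1.le⟩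
  exact ⟨t, (one_div_pos.2 hT0).trans_le ht.1, htr⟩

end ThetaRatio

section FiniteTripleProduct

open Filter Topology

/-- The reciprocal `1 / (Q; Q)_n` of the `q`-Pochhammer symbol. -/
noncomputable def qPochhammerInv (Q : ℝ) (n : ℕ) : ℝ := ∏ i ∈ Finset.range n, (1 - Q ^ (i + 1))⁻¹

/-- `qPochhammerInv` extended by zero to negative indices. -/
noncomputable def qPochhammerInvInt (Q : ℝ) (n : ℤ) : ℝ :=
  if 0 ≤ n then qPochhammerInv Q n.toNat else 0

variable {Q : ℝ}

lemma one_sub_pow_succ_pos (h0 : 0 < Q) (h1 : Q < 1) (n : ℕ) : 0 < 1 - Q ^ (n + 1) :=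
  sub_pos.2 (pow_lt_one₀ h0.le h1 n.succ_ne_zero)

lemma qPochhammerInv_succ (n : ℕ) :
    qPochhammerInv Q (n + 1) = qPochhammerInv Q n * (1 - Q ^ (n + 1))⁻¹ :=
  Finset.prod_range_succ _ _

lemma one_le_inv_one_sub_pow (h0 : 0 < Q) (h1 : Q < 1) (n : ℕ) : 1 ≤ (1 - Q ^ (n + 1))⁻¹ :=
  (one_le_inv₀ (one_sub_pow_succ_pos h0 h1 n)).2 (by linarith [pow_pos h0 (n + 1)])

lemma one_le_qPochhammerInv (h0 : 0 < Q) (h1 : Q < 1) (n : ℕ) : 1 ≤ qPochhammerInv Q n := by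
  induction n with
  | zero => simp [qPochhammerInv]
  | succ n ih =>
    rw [qPochhammerInv_succ]
    exact one_le_mul_of_one_le_of_one_le ih (one_le_inv_one_sub_pow h0 h1 n)

lemma monotone_qPochhammerInv (h0 : 0 < Q) (h1 : Q < 1) : Monotone (qPochhammerInv Q) := by
  refine monotone_nat_of_le_succ fun n => ?_
  rw [qPochhammerInv_succ]
  exact le_mul_of_one_le_right (zero_le_one.trans (one_le_qPochhammerInv h0 h1 n))
    (one_le_inv_one_sub_pow h0 h1 n)

lemma qPochhammerInv_le (h0 : 0 < Q) (h1 : Q < 1) (n : ℕ) :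
    qPochhammerInv Q n ≤ rexp ((1 - Q)⁻¹ * (1 - Q)⁻¹) := by
  have hQ : 0 < 1 - Q := sub_pos.2 h1
  calc qPochhammerInv Q n ≤ ∏ i ∈ Finset.range n, rexp (Q ^ i * (1 - Q)⁻¹) := by
        refine Finset.prod_le_prod (fun i _ => zero_le_one.trans (one_le_inv_one_sub_pow h0 h1 i))
          fun i _ => ?_
        have hp := one_sub_pow_succ_pos h0 h1 i
        have hle : Q ^ (i + 1) ≤ Q := pow_le_of_le_one h0.le h1.le i.succ_ne_zero
        have hle' : Q ^ (i + 1) ≤ Q ^ i := pow_le_pow_of_le_one h0.le h1.le i.le_succ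
        calc (1 - Q ^ (i + 1))⁻¹ = Q ^ (i + 1) * (1 - Q ^ (i + 1))⁻¹ + 1 := by
              field_simp
              ring
          _ ≤ Q ^ i * (1 - Q)⁻¹ + 1 := by gcongr
          _ ≤ _ := add_one_le_exp _
    _ = rexp ((∑ i ∈ Finset.range n, Q ^ i) * (1 - Q)⁻¹) := by
        rw [← Real.exp_sum, Finset.sum_mul]
    _ ≤ _ := by
        gcongr
        rw [← tsum_geometric_of_lt_one h0.le h1]
        exact (summable_geometric_of_lt_one h0.le h1).sum_le_tsum _ fun i _ => by positivity

lemma exists_tendsto_qPochhammerInv (h0 : 0 < Q) (h1 : Q < 1) :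
    ∃ L, 0 < L ∧ Tendsto (qPochhammerInv Q) atTop (𝓝 L) ∧ ∀ n, qPochhammerInv Q n ≤ L := by
  have hbdd : BddAbove (Set.range (qPochhammerInv Q)) :=
    ⟨_, Set.forall_mem_range.2 (qPochhammerInv_le h0 h1)⟩
  refine ⟨⨆ n, qPochhammerInv Q n, ?_, tendsto_atTop_ciSup (monotone_qPochhammerInv h0 h1) hbdd,
    le_ciSup hbdd⟩
  exact zero_lt_one.trans_le ((one_le_qPochhammerInv h0 h1 0).trans (le_ciSup hbdd 0))

lemma qPochhammerInvInt_nonneg (h0 : 0 < Q) (h1 : Q < 1) (n : ℤ) : 0 ≤ qPochhammerInvInt Q n := by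
  unfold qPochhammerInvInt
  split_ifs
  · exact zero_le_one.trans (one_le_qPochhammerInv h0 h1 _)
  · exact le_rfl

lemma qPochhammerInvInt_eq_mul (h0 : 0 < Q) (h1 : Q < 1) (n : ℤ) :
    qPochhammerInvInt Q n = (1 - Q ^ (n + 1)) * qPochhammerInvInt Q (n + 1) := by
  rcases lt_trichotomy n (-1) with h | rfl | h
  · rw [qPochhammerInvInt, qPochhammerInvInt, if_neg (by omega), if_neg (by omega), mul_zero]
  · simp [qPochhammerInvInt]
  · lift n to ℕ using by omega
    rw [qPochhammerInvInt, qPochhammerInvInt, if_pos (by omega), if_pos (by omega)]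
    have : ((n : ℤ) + 1).toNat = n + 1 := by omega
    rw [this, qPochhammerInv_succ, Int.toNat_natCast]
    have hp := (one_sub_pow_succ_pos h0 h1 n).ne'
    have hz : Q ^ ((n : ℤ) + 1) = Q ^ (n + 1) := by
      exact_mod_cast zpow_natCast Q (n + 1)
    rw [hz]
    field_simp

/-- The coefficient of `w ^ j` in `∏ m ∈ range N, (1 + q^(2 * m + 1) w) (1 + q^(2 * m + 1) / w)`, divided
by `(q²; q²)_{2N}`. -/
noncomputable def tripleCoeff (q : ℝ) (N : ℕ) (j : ℤ) : ℝ :=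
  q ^ (j ^ 2) * (qPochhammerInvInt (q ^ 2) (N + j) * qPochhammerInvInt (q ^ 2) (N - j))

variable {q : ℝ}

lemma tripleCoeff_succ (h0 : 0 < q) (h1 : q < 1) (N : ℕ) (j : ℤ) :
    (1 - q ^ (4 * N + 2)) * (1 - q ^ (4 * N + 4)) * tripleCoeff q (N + 1) j =
      (1 + q ^ (4 * N + 2)) * tripleCoeff q N j +
        q ^ (2 * N + 1) * (tripleCoeff q N (j - 1) + tripleCoeff q N (j + 1)) := by
  have hQ0 : 0 < q ^ 2 := by positivity
  have hQ1 : q ^ 2 < 1 := pow_lt_one₀ h0.le h1 two_ne_zero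
  have hq := h0.ne'
  have r := qPochhammerInvInt_eq_mul hQ0 hQ1
  have a1 := r (N + j)
  have a2 := r (N + j - 1)
  have b1 := r (N - j)
  have b2 := r (N - j - 1)
  rw [sub_add_cancel] at a2 b2
  simp only [tripleCoeff]
  rw [show ((N + 1 : ℕ) : ℤ) + j = N + j + 1 by push_cast; ring,
    show ((N + 1 : ℕ) : ℤ) - j = N - j + 1 by push_cast; ring,
    show (N : ℤ) + (j - 1) = N + j - 1 by ring, show (N : ℤ) - (j - 1) = N - j + 1 by ring,
    show (N : ℤ) + (j + 1) = N + j + 1 by ring, show (N : ℤ) - (j + 1) = N - j - 1 by ring,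
    a2, b2, a1, b1]
  set U := qPochhammerInvInt (q ^ 2) (N + j + 1)
  set V := qPochhammerInvInt (q ^ 2) (N - j + 1)
  have hA : (q ^ 2) ^ ((N : ℤ) + j) = q ^ (2 * N) * (q ^ j) ^ 2 := by
    rw [zpow_add₀ hQ0.ne', zpow_natCast, ← pow_mul, ← zpow_natCast (q ^ j), ← zpow_natCast q 2,
      ← zpow_mul, ← zpow_mul, mul_comm j]
  have hB : (q ^ 2) ^ ((N : ℤ) - j) = q ^ (2 * N) * ((q ^ j) ^ 2)⁻¹ := by
    rw [zpow_sub₀ hQ0.ne', zpow_natCast, ← pow_mul, ← zpow_natCast (q ^ j), ← zpow_natCast q 2,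
      ← zpow_mul, ← zpow_mul, mul_comm j, div_eq_mul_inv]
  have hj1 : q ^ ((j - 1) ^ 2) = q ^ (j ^ 2) * q * ((q ^ j) ^ 2)⁻¹ := by
    rw [show (j - 1) ^ 2 = j ^ 2 + 1 - j * 2 by ring, zpow_sub₀ hq, zpow_add₀ hq, zpow_one,
      zpow_mul, div_eq_mul_inv]
    rfl
  have hj2 : q ^ ((j + 1) ^ 2) = q ^ (j ^ 2) * q * (q ^ j) ^ 2 := by
    rw [show (j + 1) ^ 2 = j ^ 2 + 1 + j * 2 by ring, zpow_add₀ hq, zpow_add₀ hq, zpow_one,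
      zpow_mul]
    rfl
  rw [zpow_add₀ hQ0.ne' ((N : ℤ) + j), zpow_add₀ hQ0.ne' ((N : ℤ) - j), hA, hB, hj1, hj2, zpow_one]
  have hqj : q ^ j ≠ 0 := zpow_ne_zero _ hq
  set x := q ^ j
  rw [show q ^ (4 * N + 2) = (q ^ (2 * N)) ^ 2 * q ^ 2 by ring,
    show q ^ (4 * N + 4) = (q ^ (2 * N)) ^ 2 * q ^ 4 by ring,
    show q ^ (2 * N + 1) = q ^ (2 * N) * q by ring]
  set y := q ^ (2 * N)
  field_simp
  ring

end FiniteTripleProduct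

section LambertSeries

open Filter Topology

lemma exp_neg_pi_mul_lt_one {t : ℝ} (ht : 0 < t) : rexp (-π * t) < 1 :=
  exp_lt_one_iff.2 (by nlinarith [pi_pos])

lemma exp_neg_pi_mul_zpow_sq (t : ℝ) (j : ℤ) :
    rexp (-π * t) ^ (j ^ 2) = rexp (-π * (j : ℝ) ^ 2 * t) := by
  rw [← rpow_intCast, ← exp_mul]
  push_cast
  ring_nf

lemma exists_tendsto_tsum_tripleCoeff {t : ℝ} (ht : 0 < t) :
    ∃ L, 0 < L ∧ ∀ (c : ℤ → ℝ) (K : ℝ) (k : ℕ), (∀ n, |c n| ≤ K * |(n : ℝ)| ^ k) →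
      (∀ N, Summable fun j => c j * tripleCoeff (rexp (-π * t)) N j) ∧
      Tendsto (fun N => ∑' j, c j * tripleCoeff (rexp (-π * t)) N j) atTop
        (𝓝 (L * thetaSeries c t)) := by
  set q := rexp (-π * t) with hq
  have hq0 : 0 < q := exp_pos _
  have hQ0 : 0 < q ^ 2 := by positivity
  have hQ1 : q ^ 2 < 1 := pow_lt_one₀ hq0.le (exp_neg_pi_mul_lt_one ht) two_ne_zero
  obtain ⟨L, hL0, hL, hLle⟩ := exists_tendsto_qPochhammerInv hQ0 hQ1
  have hnonneg := qPochhammerInvInt_nonneg hQ0 hQ1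
  have hle : ∀ n, qPochhammerInvInt (q ^ 2) n ≤ L := fun n => by
    unfold qPochhammerInvInt
    split_ifs
    · exact hLle _
    · exact hL0.le
  have hlim : ∀ f : ℕ → ℤ, Tendsto f atTop atTop →
      Tendsto (fun N => qPochhammerInvInt (q ^ 2) (f N)) atTop (𝓝 L) := fun f hf => by
    have htoNat : Tendsto (fun N => (f N).toNat) atTop atTop :=
      tendsto_atTop.2 fun b => (hf.eventually_ge_atTop (b : ℤ)).mono fun N hN => by omega
    refine (hL.comp htoNat).congr' ?_
    filter_upwards [hf.eventually_ge_atTop 0] with N hN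
    rw [qPochhammerInvInt, if_pos hN, Function.comp_apply]
  refine ⟨L * L, by positivity, fun c K k hc => ?_⟩
  have hbound : ∀ N j, ‖c j * tripleCoeff q N j‖ ≤
      K * (L * L) * (|(j : ℝ)| ^ k * rexp (-π * (j : ℝ) ^ 2 * t)) := fun N j => by
    have h1 := hnonneg (N + j)
    have h2 := hnonneg (N - j)
    have h3 := hle (N + j)
    have h4 := hle (N - j)
    have h5 := (abs_nonneg _).trans (hc j)
    rw [tripleCoeff, hq, exp_neg_pi_mul_zpow_sq, ← hq, norm_mul, norm_eq_abs, norm_eq_abs,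
      abs_of_nonneg (mul_nonneg (exp_pos _).le (mul_nonneg h1 h2))]
    calc _ ≤ (K * |(j : ℝ)| ^ k) * (rexp (-π * (j : ℝ) ^ 2 * t) * (L * L)) := by
          gcongr
          exact hc j
      _ = _ := by ring
  have hsum := (summable_abs_pow_mul_exp k ht).mul_left (K * (L * L))
  refine ⟨fun N => Summable.of_norm_bounded hsum (hbound N), ?_⟩
  rw [thetaSeries, ← tsum_mul_left]
  refine tendsto_tsum_of_dominated_convergence hsum (fun j => ?_)
    (Eventually.of_forall fun N j => hbound N j)
  have h := ((hlim (fun N => N + j)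
    (tendsto_atTop_add_const_right _ _ tendsto_natCast_atTop_atTop)).mul (hlim (fun N => N - j)
    (tendsto_atTop_add_const_right _ _ tendsto_natCast_atTop_atTop))).const_mul
    (c j * rexp (-π * (j : ℝ) ^ 2 * t))
  rw [mul_comm (L * L)]
  refine h.congr fun N => ?_
  rw [tripleCoeff, hq, exp_neg_pi_mul_zpow_sq]
  ring

/-- The terms `2 q^(2 * m + 1) / (1 + q^(2 * m + 1))²` sum to `(∑ n² q^(n²)) / (∑ q^(n²))`. -/
lemma hasSum_two_mul_pow_div_one_add_pow_sq {t : ℝ} (ht : 0 < t) :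
    HasSum (fun m : ℕ => 2 * rexp (-π * t) ^ (2 * m + 1) / (1 + rexp (-π * t) ^ (2 * m + 1)) ^ 2)
      (thetaSeries (fun n => (n : ℝ) ^ 2 * 1) t / thetaThree t) := by
  obtain ⟨L, hL, h⟩ := exists_tendsto_tsum_tripleCoeff ht
  set q := rexp (-π * t) with hq
  have hq0 : 0 < q := exp_pos _
  have hq1 : q < 1 := exp_neg_pi_mul_lt_one ht
  obtain ⟨s0, l0⟩ := h (fun _ => 1) 1 0 abs_one_le_mul_pow
  obtain ⟨s1, -⟩ := h (fun n => (n : ℝ)) 1 1 (fun n => by simp)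
  obtain ⟨s2, l2⟩ := h (fun n => (n : ℝ) ^ 2 * 1) 1 2 (fun n => by simp)
  set Z : ℕ → ℝ := fun N => ∑' j, 1 * tripleCoeff q N j
  set M : ℕ → ℝ := fun N => ∑' j : ℤ, (j : ℝ) ^ 2 * 1 * tripleCoeff q N j
  have h0 : ∀ N, HasSum (fun j => 1 * tripleCoeff q N j) (Z N) := fun N => (s0 N).hasSum
  have h2 : ∀ N, HasSum (fun j : ℤ => (j : ℝ) ^ 2 * 1 * tripleCoeff q N j) (M N) :=
    fun N => (s2 N).hasSum
  set lam : ℕ → ℝ := fun N => (1 - q ^ (4 * N + 2)) * (1 - q ^ (4 * N + 4)) with hlam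
  have hlam0 : ∀ N, 0 < lam N := fun N =>
    mul_pos (sub_pos.2 (pow_lt_one₀ hq0.le hq1 (by omega)))
      (sub_pos.2 (pow_lt_one₀ hq0.le hq1 (by omega)))
  have hZ : ∀ N, lam N * Z (N + 1) = (1 + q ^ (2 * N + 1)) ^ 2 * Z N := fun N => by
    have hs := ((h0 N).mul_left (1 + q ^ (4 * N + 2))).add
      ((((Equiv.subRight (1 : ℤ)).hasSum_iff.2 (h0 N)).add
        ((Equiv.addRight (1 : ℤ)).hasSum_iff.2 (h0 N))).mul_left (q ^ (2 * N + 1)))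
    refine (((h0 (N + 1)).mul_left (lam N)).unique
      ((hs.congr_fun fun j => ?_))).trans ?_
    · simp only [Function.comp_apply, Equiv.subRight_apply, Equiv.coe_addRight, one_mul]
      exact tripleCoeff_succ hq0 hq1 N j
    · ring
  have hM : ∀ N, lam N * M (N + 1) =
      (1 + q ^ (2 * N + 1)) ^ 2 * M N + 2 * q ^ (2 * N + 1) * Z N := fun N => by
    have h1 := (s1 N).hasSum
    have hp : HasSum (fun j : ℤ => ((j : ℝ) + 1) ^ 2 * tripleCoeff q N j) _ :=
      (((h2 N).add (h1.mul_left 2)).add (h0 N)).congr_fun fun j => by ring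
    have hm : HasSum (fun j : ℤ => ((j : ℝ) - 1) ^ 2 * tripleCoeff q N j) _ :=
      (((h2 N).sub (h1.mul_left 2)).add (h0 N)).congr_fun fun j => by ring
    have hs := ((h2 N).mul_left (1 + q ^ (4 * N + 2))).add
      ((((Equiv.subRight (1 : ℤ)).hasSum_iff.2 hp).add
        ((Equiv.addRight (1 : ℤ)).hasSum_iff.2 hm)).mul_left (q ^ (2 * N + 1)))
    refine (((h2 (N + 1)).mul_left (lam N)).unique
      ((hs.congr_fun fun j => ?_))).trans ?_
    · simp only [Function.comp_apply, Equiv.subRight_apply, Equiv.coe_addRight]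
      push_cast
      linear_combination (j : ℝ) ^ 2 * tripleCoeff_succ hq0 hq1 N j
    · ring
  have hZ0 : Z 0 = 1 := by
    refine (tsum_eq_single 0 fun j hj => ?_).trans ?_
    · rcases hj.lt_or_gt with hj | hj
      · simp [tripleCoeff, qPochhammerInvInt, not_le.2 hj]
      · simp [tripleCoeff, qPochhammerInvInt, not_le.2 hj]
    · simp [tripleCoeff, qPochhammerInvInt, qPochhammerInv]
  have hM0 : M 0 = 0 := by
    refine (tsum_congr fun j => ?_).trans tsum_zero
    rcases lt_trichotomy j 0 with hj | rfl | hj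
    · simp [tripleCoeff, qPochhammerInvInt, not_le.2 hj]
    · simp
    · simp [tripleCoeff, qPochhammerInvInt, not_le.2 hj]
  have hZpos : ∀ N, 0 < Z N := fun N => by
    induction N with
    | zero => rw [hZ0]; exact one_pos
    | succ N ih =>
      refine pos_of_mul_pos_right (a := lam N) ?_ (hlam0 N).le
      rw [hZ]
      positivity
  have hpartial : ∀ N, M N / Z N =
      ∑ m ∈ Finset.range N, 2 * q ^ (2 * m + 1) / (1 + q ^ (2 * m + 1)) ^ 2 := fun N => by
    induction N with
    | zero => rw [hM0, zero_div, Finset.sum_range_zero]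
    | succ N ih =>
      have hne := (hZpos N).ne'
      have hne' : 1 + q ^ (2 * N + 1) ≠ 0 := by positivity
      rw [Finset.sum_range_succ, ← ih, ← mul_div_mul_left (M (N + 1)) _ (hlam0 N).ne', hM, hZ]
      field_simp
  rw [hasSum_iff_tendsto_nat_of_nonneg fun m => by positivity]
  have hθ := thetaThree_pos ht
  have hlim := l2.div l0 (mul_pos hL hθ).ne'
  rw [mul_div_mul_left _ _ hL.ne'] at hlim
  exact hlim.congr hpartial

lemma tsum_one_div_cosh_sq {t : ℝ} (ht : 0 < t) :
    ∑' m : ℕ+, 1 / cosh (π * t * ((m : ℝ) - 1 / 2)) ^ 2 =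
      -(2 / π) * (thetaThreeDeriv t / thetaThree t) := by
  rw [tsum_pnat_eq_tsum_succ (f := fun m => 1 / cosh (π * t * ((m : ℝ) - 1 / 2)) ^ 2),
    thetaThreeDeriv]
  refine (((hasSum_two_mul_pow_div_one_add_pow_sq ht).mul_left 2).congr_fun
    fun m => ?_).tsum_eq.trans ?_
  · have hx : rexp (-π * t) ^ (2 * m + 1) = rexp (-(π * t * (m + 1 / 2))) ^ 2 := by
      rw [← exp_nat_mul, ← exp_nat_mul]
      push_cast
      ring_nf
    rw [hx, cosh_eq, show π * t * (((m + 1 : ℕ) : ℝ) - 1 / 2) = π * t * (m + 1 / 2) by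
      push_cast; ring, exp_neg]
    have := exp_pos (π * t * (m + 1 / 2))
    field_simp
  · have := pi_pos
    field_simp

end LambertSeries

section EllipticIntegrals

open Filter Topology MeasureTheory Set

/-- Gauss's form of the complete elliptic integral of the first kind. -/
noncomputable def gaussIntegral (a b : ℝ) : ℝ :=
  ∫ θ in (0 : ℝ)..π / 2, 1 / √(a ^ 2 * cos θ ^ 2 + b ^ 2 * sin θ ^ 2)

lemma gaussForm_pos {a b : ℝ} (ha : 0 < a) (hb : 0 < b) (θ : ℝ) :
    0 < a ^ 2 * cos θ ^ 2 + b ^ 2 * sin θ ^ 2 := by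
  rcases eq_or_ne (cos θ) 0 with h | h
  · have := sin_sq_add_cos_sq θ
    rw [h] at this ⊢
    have h1 : sin θ ^ 2 = 1 := by linarith
    rw [h1]
    positivity
  · positivity

lemma integral_zero_one_eq_integral_sin (f : ℝ → ℝ) :
    ∫ t in (0 : ℝ)..1, f t = ∫ θ in (0 : ℝ)..π / 2, cos θ * f (sin θ) := by
  have himage : sin '' Ioo 0 (π / 2) = Ioo 0 1 := by
    ext t
    constructor
    · rintro ⟨θ, hθ, rfl⟩
      refine ⟨sin_pos_of_pos_of_lt_pi hθ.1 (by linarith [hθ.2, pi_pos]), ?_⟩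
      rw [← sin_pi_div_two]
      exact sin_lt_sin_of_lt_of_le_pi_div_two (by linarith [hθ.1, pi_pos]) le_rfl hθ.2
    · rintro ⟨h0, h1⟩
      exact ⟨arcsin t, ⟨arcsin_pos.2 h0, arcsin_lt_pi_div_two.2 h1⟩,
        sin_arcsin (by linarith) h1.le⟩
  have hinj : InjOn sin (Ioo 0 (π / 2)) :=
    injOn_sin.mono (Ioo_subset_Icc_self.trans (Icc_subset_Icc_left (by linarith [pi_pos])))
  rw [intervalIntegral.integral_of_le zero_le_one, intervalIntegral.integral_of_le (by positivity),
    integral_Ioc_eq_integral_Ioo, integral_Ioc_eq_integral_Ioo, ← himage,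
    integral_image_eq_integral_abs_deriv_smul measurableSet_Ioo
      (fun θ _ => (hasDerivAt_sin θ).hasDerivWithinAt) hinj]
  refine setIntegral_congr_fun measurableSet_Ioo fun θ hθ => ?_
  rw [abs_of_pos (cos_pos_of_mem_Ioo ⟨by linarith [hθ.1, pi_pos], hθ.2⟩), smul_eq_mul]

lemma ellipticK_eq_gaussIntegral {k r : ℝ} (h : k ^ 2 + r ^ 2 = 1) :
    ellipticK k = gaussIntegral 1 r := by
  rw [ellipticK, integral_zero_one_eq_integral_sin, gaussIntegral,
    intervalIntegral.integral_of_le (by positivity), intervalIntegral.integral_of_le (by positivity),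
    integral_Ioc_eq_integral_Ioo, integral_Ioc_eq_integral_Ioo]
  refine setIntegral_congr_fun measurableSet_Ioo fun θ hθ => ?_
  have hc : 0 < cos θ := cos_pos_of_mem_Ioo ⟨by linarith [hθ.1, pi_pos], hθ.2⟩
  have hsc := sin_sq_add_cos_sq θ
  rw [show 1 - sin θ ^ 2 = cos θ ^ 2 by linarith, sqrt_mul (sq_nonneg _), sqrt_sq hc.le,
    show 1 - k ^ 2 * sin θ ^ 2 = 1 ^ 2 * cos θ ^ 2 + r ^ 2 * sin θ ^ 2 by
      linear_combination -hsc - sin θ ^ 2 * h]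
  field_simp

lemma ellipticE_eq_integral_sin {k r : ℝ} (h : k ^ 2 + r ^ 2 = 1) :
    ellipticE k = ∫ θ in (0 : ℝ)..π / 2, √(1 ^ 2 * cos θ ^ 2 + r ^ 2 * sin θ ^ 2) := by
  rw [ellipticE, integral_zero_one_eq_integral_sin,
    intervalIntegral.integral_of_le (by positivity), intervalIntegral.integral_of_le (by positivity),
    integral_Ioc_eq_integral_Ioo, integral_Ioc_eq_integral_Ioo]
  refine setIntegral_congr_fun measurableSet_Ioo fun θ hθ => ?_
  have hc : 0 < cos θ := cos_pos_of_mem_Ioo ⟨by linarith [hθ.1, pi_pos], hθ.2⟩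
  have hsc := sin_sq_add_cos_sq θ
  rw [show 1 - sin θ ^ 2 = cos θ ^ 2 by linarith, sqrt_div' _ (sq_nonneg _), sqrt_sq hc.le,
    show 1 - k ^ 2 * sin θ ^ 2 = 1 ^ 2 * cos θ ^ 2 + r ^ 2 * sin θ ^ 2 by
      linear_combination -hsc - sin θ ^ 2 * h]
  field_simp

lemma gaussIntegral_eq_integral_Ioi {a b : ℝ} (hb : 0 < b) :
    gaussIntegral a b = ∫ x in Ioi (0 : ℝ), 1 / √((x ^ 2 + a ^ 2) * (x ^ 2 + b ^ 2)) := by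
  have himage : (fun θ => b * tan θ) '' Ioo 0 (π / 2) = Ioi 0 := by
    ext x
    constructor
    · rintro ⟨θ, hθ, rfl⟩
      exact mul_pos hb (tan_pos_of_pos_of_lt_pi_div_two hθ.1 hθ.2)
    · intro hx
      refine ⟨arctan (x / b), ⟨arctan_pos.2 (div_pos hx hb), arctan_lt_pi_div_two _⟩, ?_⟩
      simp only [tan_arctan]
      field_simp
  have hinj : InjOn (fun θ => b * tan θ) (Ioo 0 (π / 2)) := by
    intro x hx y hy hxy
    exact injOn_tan ⟨by linarith [hx.1, pi_pos], hx.2⟩ ⟨by linarith [hy.1, pi_pos], hy.2⟩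
      (mul_left_cancel₀ hb.ne' hxy)
  have hcos : ∀ θ ∈ Ioo 0 (π / 2), 0 < cos θ := fun θ hθ =>
    cos_pos_of_mem_Ioo ⟨by linarith [hθ.1, pi_pos], hθ.2⟩
  rw [gaussIntegral, intervalIntegral.integral_of_le (by positivity), integral_Ioc_eq_integral_Ioo,
    ← himage, integral_image_eq_integral_abs_deriv_smul measurableSet_Ioo
      (fun θ hθ => ((hasDerivAt_tan (hcos θ hθ).ne').const_mul b).hasDerivWithinAt) hinj]
  refine setIntegral_congr_fun measurableSet_Ioo fun θ hθ => ?_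
  have hc := hcos θ hθ
  have hsc := sin_sq_add_cos_sq θ
  rw [abs_of_pos (by positivity), smul_eq_mul, tan_eq_sin_div_cos,
    show ((b * (sin θ / cos θ)) ^ 2 + a ^ 2) * ((b * (sin θ / cos θ)) ^ 2 + b ^ 2) =
      (b / cos θ ^ 2) ^ 2 * (a ^ 2 * cos θ ^ 2 + b ^ 2 * sin θ ^ 2) by
      field_simp
      linear_combination (b ^ 2 * sin θ ^ 2 + a ^ 2 * cos θ ^ 2) * hsc,
    sqrt_mul (sq_nonneg _), sqrt_sq (by positivity)]
  field_simp

lemma two_mul_gaussIntegral {a b : ℝ} (hb : 0 < b) :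
    2 * gaussIntegral a b = ∫ x : ℝ, 1 / √((x ^ 2 + a ^ 2) * (x ^ 2 + b ^ 2)) := by
  rw [gaussIntegral_eq_integral_Ioi hb,
    ← integral_comp_abs (f := fun x => 1 / √((x ^ 2 + a ^ 2) * (x ^ 2 + b ^ 2)))]
  simp only [sq_abs]

/-- Gauss's invariance under the arithmetic-geometric mean step. -/
lemma gaussIntegral_agm_step {a b m g : ℝ} (ha : 0 < a) (hb : 0 < b) (hg : 0 < g)
    (hm : a + b = 2 * m) (hg2 : a * b = g ^ 2) : gaussIntegral m g = gaussIntegral a b := by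
  have hab : 0 < a * b := mul_pos ha hb
  suffices h : 2 * gaussIntegral m g = 2 * gaussIntegral a b by linarith
  rw [two_mul_gaussIntegral hg, gaussIntegral_eq_integral_Ioi hb]
  have himage : (fun x => (x - a * b / x) / 2) '' Ioi 0 = univ := by
    refine eq_univ_of_forall fun u => ?_
    have hpos : 0 < u + √(u ^ 2 + a * b) := by
      have : √(u ^ 2) < √(u ^ 2 + a * b) := sqrt_lt_sqrt (sq_nonneg _) (by linarith)
      rw [sqrt_sq_eq_abs] at this
      linarith [neg_abs_le u]
    refine ⟨u + √(u ^ 2 + a * b), hpos, ?_⟩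
    have hs : √(u ^ 2 + a * b) ^ 2 = u ^ 2 + a * b := sq_sqrt (by positivity)
    field_simp
    linear_combination hs
  have hinj : InjOn (fun x => (x - a * b / x) / 2) (Ioi 0) := by
    refine StrictMonoOn.injOn fun x hx y hy hxy => ?_
    have : a * b / y < a * b / x := div_lt_div_of_pos_left hab hx hxy
    linarith
  have hderiv : ∀ x ∈ Ioi (0 : ℝ), HasDerivWithinAt (fun x => (x - a * b / x) / 2)
      ((1 + a * b / x ^ 2) / 2) (Ioi 0) x := by
    intro x hx
    have hx0 : x ≠ 0 := (ne_of_gt hx)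
    have h := (((hasDerivAt_id x).sub ((hasDerivAt_inv hx0).const_mul (a * b))).div_const 2)
    refine (h.congr_deriv ?_).hasDerivWithinAt.congr (fun y _ => ?_) ?_
    · field_simp
      ring
    · simp [div_eq_mul_inv]
    · simp [div_eq_mul_inv]
  rw [← setIntegral_univ, ← himage,
    integral_image_eq_integral_abs_deriv_smul measurableSet_Ioi hderiv hinj, ← integral_const_mul]
  refine setIntegral_congr_fun measurableSet_Ioi fun x hx => ?_
  have hx0 : 0 < x := hx
  rw [abs_of_pos (by positivity), smul_eq_mul,
    show (((x - a * b / x) / 2) ^ 2 + m ^ 2) * (((x - a * b / x) / 2) ^ 2 + g ^ 2) =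
      ((x + a * b / x) / (4 * x)) ^ 2 * ((x ^ 2 + a ^ 2) * (x ^ 2 + b ^ 2)) by
      rw [← hg2, show m = (a + b) / 2 by linarith]
      field_simp
      ring,
    sqrt_mul (sq_nonneg _), sqrt_sq (by positivity)]
  have : 0 < √((x ^ 2 + a ^ 2) * (x ^ 2 + b ^ 2)) := sqrt_pos.2 (by positivity)
  field_simp
  ring

lemma gaussIntegral_mul {c a b : ℝ} (hc : 0 < c) :
    c * gaussIntegral (c * a) (c * b) = gaussIntegral a b := by
  rw [gaussIntegral, gaussIntegral, ← intervalIntegral.integral_const_mul]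
  congr 1
  ext θ
  rw [show (c * a) ^ 2 * cos θ ^ 2 + (c * b) ^ 2 * sin θ ^ 2 =
    c ^ 2 * (a ^ 2 * cos θ ^ 2 + b ^ 2 * sin θ ^ 2) by ring, sqrt_mul (sq_nonneg _), sqrt_sq hc.le]
  field_simp

lemma continuous_gaussIntegrand {a b : ℝ} (ha : 0 < a) (hb : 0 < b) :
    Continuous fun θ => 1 / √(a ^ 2 * cos θ ^ 2 + b ^ 2 * sin θ ^ 2) := by
  refine continuous_const.div (by fun_prop) fun θ => ?_
  exact (sqrt_pos.2 (gaussForm_pos ha hb θ)).ne'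

lemma gaussIntegral_self {a : ℝ} (ha : 0 < a) : gaussIntegral a a = π / 2 / a := by
  have : ∀ θ, a ^ 2 * cos θ ^ 2 + a ^ 2 * sin θ ^ 2 = a ^ 2 := fun θ => by
    linear_combination a ^ 2 * sin_sq_add_cos_sq θ
  simp only [gaussIntegral, this, sqrt_sq ha.le]
  simp [div_eq_mul_inv]

lemma gaussIntegral_anti {a b c d : ℝ} (ha : 0 < a) (hb : 0 < b) (hac : a ≤ c) (hbd : b ≤ d) :
    gaussIntegral c d ≤ gaussIntegral a b := by
  refine intervalIntegral.integral_mono_on (by positivity)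
    ((continuous_gaussIntegrand (ha.trans_le hac) (hb.trans_le hbd)).intervalIntegrable _ _)
    ((continuous_gaussIntegrand ha hb).intervalIntegrable _ _) fun θ _ => ?_
  refine one_div_le_one_div_of_le (sqrt_pos.2 (gaussForm_pos ha hb θ)) (sqrt_le_sqrt ?_)
  gcongr

/-- The derivative of the complete elliptic integral in terms of the complementary modulus. -/
lemma hasDerivAt_gaussIntegral {r : ℝ} (hr : r ∈ Ioo (0 : ℝ) 1) :
    HasDerivAt (gaussIntegral 1)
      (-((∫ θ in (0 : ℝ)..π / 2, √(1 ^ 2 * cos θ ^ 2 + r ^ 2 * sin θ ^ 2)) -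
        r ^ 2 * gaussIntegral 1 r) / (r * (1 - r ^ 2))) r := by
  obtain ⟨hr0, hr1⟩ := hr
  have hcont : ∀ {x : ℝ}, 0 < x → Continuous fun θ =>
      -(x * sin θ ^ 2) / √(1 ^ 2 * cos θ ^ 2 + x ^ 2 * sin θ ^ 2) ^ 3 := fun {x} hx =>
    Continuous.div (by fun_prop) (by fun_prop) fun θ =>
      (pow_pos (sqrt_pos.2 (gaussForm_pos one_pos hx θ)) 3).ne'
  have hmem : ∀ x ∈ Metric.ball r (r / 2), r / 2 < x ∧ x < 2 * r := fun x hx => by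
    rw [Metric.mem_ball, Real.dist_eq, abs_lt] at hx
    constructor <;> linarith
  have hmain := intervalIntegral.hasDerivAt_integral_of_dominated_loc_of_deriv_le
    (F := fun x θ => 1 / √(1 ^ 2 * cos θ ^ 2 + x ^ 2 * sin θ ^ 2))
    (F' := fun x θ => -(x * sin θ ^ 2) / √(1 ^ 2 * cos θ ^ 2 + x ^ 2 * sin θ ^ 2) ^ 3)
    (x₀ := r) (μ := volume) (a := 0) (b := π / 2) (s := Metric.ball r (r / 2))
    (bound := fun _ => 2 * r / (r / 2) ^ 3)
    (Metric.ball_mem_nhds r (half_pos hr0))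
    (by
      filter_upwards [Metric.ball_mem_nhds r (half_pos hr0)] with x hx
      have := hmem x hx
      exact (continuous_gaussIntegrand one_pos (by linarith)).aestronglyMeasurable)
    ((continuous_gaussIntegrand one_pos hr0).intervalIntegrable _ _)
    (hcont hr0).aestronglyMeasurable
    (by
      refine ae_of_all _ fun θ _ x hx => ?_
      obtain ⟨h1, h2⟩ := hmem x hx
      have hs : r / 2 ≤ √(1 ^ 2 * cos θ ^ 2 + x ^ 2 * sin θ ^ 2) := by
        refine le_sqrt_of_sq_le ?_
        have h3 : (r / 2) ^ 2 ≤ x ^ 2 := by gcongr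
        have h4 : (r / 2) ^ 2 ≤ 1 := by nlinarith
        have := sin_sq_add_cos_sq θ
        nlinarith [mul_le_mul_of_nonneg_right h3 (sq_nonneg (sin θ)),
          mul_le_mul_of_nonneg_right h4 (sq_nonneg (cos θ))]
      rw [norm_div, norm_neg, norm_eq_abs, norm_eq_abs, abs_of_nonneg (by
        have : 0 < x := by linarith
        positivity), abs_of_nonneg (by positivity)]
      have : x * sin θ ^ 2 ≤ 2 * r := by
        have := sin_sq_le_one θ
        nlinarith [sq_nonneg (sin θ)]
      gcongr)
    intervalIntegrable_const
    (by
      refine ae_of_all _ fun θ _ x hx => ?_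
      have hx0 : 0 < x := by linarith [(hmem x hx).1]
      have hQ := gaussForm_pos one_pos hx0 θ
      have hsq := sq_sqrt hQ.le
      have hsp := sqrt_pos.2 hQ
      have h := ((((hasDerivAt_id x).pow 2).mul_const (sin θ ^ 2)).const_add
        (1 ^ 2 * cos θ ^ 2)).sqrt hQ.ne'
      have h2 := h.inv hsp.ne'
      refine (h2.congr_deriv ?_).congr_of_eventuallyEq (Eventually.of_forall fun y => ?_)
      · simp only [id]
        simp only [Pi.pow_apply, id]
        field_simp
        push_cast
        ring
      · simp)
  refine hmain.2.congr_deriv ?_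
  have hboundary : ∫ θ in (0 : ℝ)..π / 2,
      (cos θ ^ 2 / √(1 ^ 2 * cos θ ^ 2 + r ^ 2 * sin θ ^ 2) -
        r ^ 2 * sin θ ^ 2 / √(1 ^ 2 * cos θ ^ 2 + r ^ 2 * sin θ ^ 2) ^ 3) = 0 := by
    rw [intervalIntegral.integral_eq_sub_of_hasDerivAt
      (f := fun θ => sin θ * cos θ / √(1 ^ 2 * cos θ ^ 2 + r ^ 2 * sin θ ^ 2))]
    · simp
    · intro θ _
      have hQ := gaussForm_pos one_pos hr0 θ
      have hsq := sq_sqrt hQ.le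
      have hsp := sqrt_pos.2 hQ
      have hsc := sin_sq_add_cos_sq θ
      have h := ((((hasDerivAt_cos θ).pow 2).const_mul (1 ^ 2)).add
        (((hasDerivAt_sin θ).pow 2).const_mul (r ^ 2))).sqrt hQ.ne'
      have h2 := ((hasDerivAt_sin θ).mul (hasDerivAt_cos θ)).div h hsp.ne'
      refine h2.congr_deriv ?_
      simp only [Pi.add_apply, Pi.pow_apply, Pi.mul_apply]
      set w := √(1 ^ 2 * cos θ ^ 2 + r ^ 2 * sin θ ^ 2)
      field_simp
      norm_num
      linear_combination (-2 * sin θ ^ 2) * hsq - 2 * sin θ ^ 2 * r ^ 2 * hsc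
    · refine Continuous.intervalIntegrable ?_ _ _
      refine (Continuous.div (by fun_prop) (by fun_prop) fun θ => ?_).sub
        (Continuous.div (by fun_prop) (by fun_prop) fun θ => ?_)
      · exact (sqrt_pos.2 (gaussForm_pos one_pos hr0 θ)).ne'
      · exact (pow_pos (sqrt_pos.2 (gaussForm_pos one_pos hr0 θ)) 3).ne'
  have hr2 : 0 < 1 - r ^ 2 := by nlinarith
  have hI := hmain.1.mul_const (r * (1 - r ^ 2))
  have hE : IntervalIntegrable (fun θ => √(1 ^ 2 * cos θ ^ 2 + r ^ 2 * sin θ ^ 2)) volume 0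
    (π / 2) := Continuous.intervalIntegrable (by fun_prop) _ _
  have hK := ((continuous_gaussIntegrand one_pos hr0).const_mul (r ^ 2)).intervalIntegrable
    (μ := volume) 0 (π / 2)
  have hsum := intervalIntegral.integral_add hI (hE.sub hK)
  rw [intervalIntegral.integral_sub hE hK, intervalIntegral.integral_mul_const,
    intervalIntegral.integral_const_mul] at hsum
  have hzero := congrArg ((1 - r ^ 2) * ·) hboundary
  simp only [mul_zero] at hzero
  rw [← intervalIntegral.integral_const_mul] at hzero
  rw [eq_div_iff (by positivity), gaussIntegral, eq_neg_iff_add_eq_zero, ← hsum]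
  refine (intervalIntegral.integral_congr fun θ _ => ?_).trans hzero
  have hQ := gaussForm_pos one_pos hr0 θ
  have hsq := sq_sqrt hQ.le
  have hsp := sqrt_pos.2 hQ
  have hsc := sin_sq_add_cos_sq θ
  set w := √(1 ^ 2 * cos θ ^ 2 + r ^ 2 * sin θ ^ 2)
  field_simp
  linear_combination w ^ 2 * hsq + w ^ 2 * r ^ 2 * hsc

end EllipticIntegrals

section EllipticTheta

open Filter Topology Set

lemma gaussIntegral_thetaThree_sq_thetaFour_sq {t : ℝ} (ht : 0 < t) :
    gaussIntegral (thetaThree t ^ 2) (thetaFour t ^ 2) = π / 2 := by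
  have hpos3 : ∀ {s : ℝ}, 0 < s → 0 < thetaThree s ^ 2 := fun hs => pow_pos (thetaThree_pos hs) 2
  have hpos4 : ∀ {s : ℝ}, 0 < s → 0 < thetaFour s ^ 2 := fun hs =>
    (sq_nonneg _).lt_of_ne' (pow_ne_zero 2 (thetaFour_ne_zero hs))
  have hpos : ∀ n : ℕ, 0 < 2 ^ n * t := fun n => by positivity
  have hinv : ∀ n : ℕ, gaussIntegral (thetaThree (2 ^ n * t) ^ 2) (thetaFour (2 ^ n * t) ^ 2) =
      gaussIntegral (thetaThree t ^ 2) (thetaFour t ^ 2) := fun n => by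
    induction n with
    | zero => rw [pow_zero, one_mul]
    | succ n ih =>
      have hs := hpos n
      rw [← ih, pow_succ' 2 n, mul_assoc]
      refine gaussIntegral_agm_step (hpos3 hs) (hpos4 hs) (hpos4 (by positivity))
        (thetaThree_sq_add_thetaFour_sq hs) ?_
      rw [← thetaThree_mul_thetaFour hs, mul_pow]
  have hlim := tendsto_two_pow_mul ht
  have hlower : Tendsto (fun n : ℕ => π / 2 / thetaThree (2 ^ n * t) ^ 2) atTop (𝓝 (π / 2)) := by
    have h := (tendsto_const_nhds (x := π / 2)).div ((tendsto_thetaThree.comp hlim).pow 2)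
      (by norm_num)
    rwa [one_pow, div_one] at h
  have hupper : Tendsto (fun n : ℕ => π / 2 / thetaFour (2 ^ n * t) ^ 2) atTop (𝓝 (π / 2)) := by
    have h := (tendsto_const_nhds (x := π / 2)).div ((tendsto_thetaFour.comp hlim).pow 2)
      (by norm_num)
    rwa [one_pow, div_one] at h
  refine le_antisymm (ge_of_tendsto' hupper fun n => ?_) (le_of_tendsto' hlower fun n => ?_)
  · rw [← hinv n, ← gaussIntegral_self (hpos4 (hpos n))]
    exact gaussIntegral_anti (hpos4 (hpos n)) (hpos4 (hpos n))
      (thetaFour_sq_lt_thetaThree_sq (hpos n)).le le_rfl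
  · rw [← hinv n, ← gaussIntegral_self (hpos3 (hpos n))]
    exact gaussIntegral_anti (hpos3 (hpos n)) (hpos4 (hpos n)) le_rfl
      (thetaFour_sq_lt_thetaThree_sq (hpos n)).le

lemma gaussIntegral_one_thetaRatio {t : ℝ} (ht : 0 < t) :
    gaussIntegral 1 (thetaRatio t) = π / 2 * thetaThree t ^ 2 := by
  have h3 : 0 < thetaThree t ^ 2 := pow_pos (thetaThree_pos ht) 2
  rw [← gaussIntegral_mul h3, mul_one, thetaRatio, mul_div_cancel₀ _ h3.ne',
    gaussIntegral_thetaThree_sq_thetaFour_sq ht, mul_comm]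

/-- The logarithmic derivative of `θ₃` in terms of elliptic integrals. -/
lemma thetaThreeDeriv_div_thetaThree {t k : ℝ} (ht : 0 < t) (hk : k ^ 2 + thetaRatio t ^ 2 = 1) :
    -(2 / π) * (thetaThreeDeriv t / thetaThree t) =
      2 / π ^ 2 * ellipticK k * (ellipticE k - thetaRatio t ^ 2 * ellipticK k) := by
  have hr0 := thetaRatio_pos ht
  have hr1 := thetaRatio_lt_one ht
  have h3 := thetaThree_pos ht
  have hK : ellipticK k = π / 2 * thetaThree t ^ 2 :=
    (ellipticK_eq_gaussIntegral hk).trans (gaussIntegral_one_thetaRatio ht)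
  have hcomp := (hasDerivAt_gaussIntegral ⟨hr0, hr1⟩).comp t (hasDerivAt_thetaRatio ht)
  have hsq := ((hasDerivAt_thetaThree ht).pow 2).const_mul (π / 2)
  have huniq := hcomp.unique (hsq.congr_of_eventuallyEq
    ((eventually_gt_nhds ht).mono fun s hs => gaussIntegral_one_thetaRatio hs))
  rw [← ellipticE_eq_integral_sin hk, ← ellipticK_eq_gaussIntegral hk, thetaRatioLogDeriv_eq ht]
    at huniq
  have hB : thetaFour t ^ 2 = thetaRatio t * thetaThree t ^ 2 := by
    rw [thetaRatio, div_mul_cancel₀ _ (by positivity)]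
  have hr2 : 0 < 1 - thetaRatio t ^ 2 := by nlinarith
  have hE : -(ellipticE k - thetaRatio t ^ 2 * ellipticK k) * thetaThree t ^ 3 =
      2 * thetaThreeDeriv t := by
    refine mul_left_cancel₀ (a := π / 2 * thetaThree t) (by positivity) ?_
    rw [hB] at huniq
    refine Eq.trans ?_ (huniq.trans ?_)
    · field_simp
    · push_cast
      ring
  rw [show thetaThreeDeriv t =
    -(ellipticE k - thetaRatio t ^ 2 * ellipticK k) * thetaThree t ^ 3 / 2 by linarith, hK]
  field_simp

end EllipticTheta

/-- The sum of inverse squared hyperbolic cosines at `x = xRatio k`. -/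
theorem sech_sq_sum_elliptic (k : ℝ) (hk : k ∈ Set.Ioo (0:ℝ) 1) :
    ∑' m : ℕ+, 1 / Real.cosh (π * xRatio k * ((m : ℝ) - 1 / 2)) ^ 2 =
      (2 / π ^ 2) * ellipticK k * ellipticE k -
        (2 * (1 - k ^ 2) / π ^ 2) * ellipticK k ^ 2 := by
  obtain ⟨hk0, hk1⟩ := hk
  have hk2 : 0 < 1 - k ^ 2 := by nlinarith
  have hsq : √(1 - k ^ 2) ^ 2 = 1 - k ^ 2 := sq_sqrt hk2.le
  obtain ⟨t, ht, hr⟩ := exists_thetaRatio_eq (r := √(1 - k ^ 2))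
    ⟨sqrt_pos.2 hk2, (sqrt_lt' one_pos).2 (by nlinarith)⟩
  have hkr : k ^ 2 + thetaRatio t ^ 2 = 1 := by rw [hr, hsq]; ring
  have hk' : thetaRatio (1 / t) = k :=
    (pow_left_inj₀ (thetaRatio_pos (one_div_pos.2 ht)).le hk0.le two_ne_zero).1
      (by linarith [thetaRatio_sq_add_sq ht])
  have h3 := thetaThree_pos ht
  have hx : xRatio k = t := by
    rw [xRatio, ellipticK_eq_gaussIntegral hkr,
      ellipticK_eq_gaussIntegral (r := k) (by rw [hsq]; ring), gaussIntegral_one_thetaRatio ht]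
    nth_rewrite 1 [← hk']
    rw [gaussIntegral_one_thetaRatio (one_div_pos.2 ht), thetaThree_one_div_sq ht]
    field_simp
  rw [hx, tsum_one_div_cosh_sq ht, thetaThreeDeriv_div_thetaThree ht hkr, hr, hsq]
  ring
end
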